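/- Let n ≥ 2 and let K and L be origin-symmetric convex bodies in R^n such that Π_K(t) ≤ Π_L(t) for all t ≥ 0. Then |K|^{(n-1)/n} ≤ vr(L) · |L|^{(n-1)/n}, where vr(L) is the volume ratio of L. -/

import Mathlib

open MeasureTheory Metric Set
open scoped RealInnerProductSpace ENNReal NNReal

noncomputable section

/-- Euclidean space `ℝ^n`. -/
abbrev Euc (n : ℕ) := EuclideanSpace ℝ (Fin n)

/-- A convex body: a compact convex set with nonempty interior. -/
def IsConvexBody {n : ℕ} (K : Set (Euc n)) : Prop :=
  Convex ℝ K ∧ IsCompact K ∧ (interior K).Nonempty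

/-- The Haar (rotation invariant) probability measure of a set of directions on the
unit sphere `S^{n-1}`, realized as normalized `(n-1)`-dimensional Hausdorff measure. -/
def sphHaar (n : ℕ) (A : Set (Euc n)) : ℝ≥0∞ :=
  μH[(n : ℝ) - 1] (A ∩ sphere (0 : Euc n) 1) / μH[(n : ℝ) - 1] (sphere (0 : Euc n) 1)

/-- `|K ∩ θ^⊥|`: the `(n-1)`-dimensional Hausdorff measure of the central section of `K`
perpendicular to `θ`. -/
def sectionVol (n : ℕ) (K : Set (Euc n)) (θ : Euc n) : ℝ≥0∞ :=
  μH[(n : ℝ) - 1] (K ∩ {x : Euc n | ⟪x, θ⟫ = 0})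

/-- `S_K(t)`: distribution function of the areas of central hyperplane sections. -/
def Sdist (n : ℕ) (K : Set (Euc n)) (t : ℝ) : ℝ≥0∞ :=
  sphHaar n {θ : Euc n | ENNReal.ofReal t ≤ sectionVol n K θ}

/-- `|K | θ^⊥|`: the `(n-1)`-dimensional Hausdorff measure of the orthogonal projection
of `K` onto the hyperplane `θ^⊥` (for a unit vector `θ`). -/
def projVol (n : ℕ) (K : Set (Euc n)) (θ : Euc n) : ℝ≥0∞ :=
  μH[(n : ℝ) - 1] ((fun x => x - ⟪x, θ⟫ • θ) '' K)

/-- `Π_K(t)`: distribution function of the volumes of hyperplane projections. -/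
def PiDist (n : ℕ) (K : Set (Euc n)) (t : ℝ) : ℝ≥0∞ :=
  sphHaar n {θ : Euc n | ENNReal.ofReal t ≤ projVol n K θ}

/-- The radial function `ρ_K(θ) = max {a ≥ 0 : a • θ ∈ K}`. -/
def radial {n : ℕ} (K : Set (Euc n)) (θ : Euc n) : ℝ :=
  sSup {a : ℝ | 0 ≤ a ∧ a • θ ∈ K}

/-- The support function `h_K(θ) = sup_{y ∈ K} ⟨θ, y⟩`. -/
def suppFn {n : ℕ} (K : Set (Euc n)) (θ : Euc n) : ℝ :=
  sSup ((fun y => ⟪θ, y⟫) '' K)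

/-- The polar body `K° = {x : ⟨x, y⟩ ≤ 1 for all y ∈ K}`. -/
def polarBody {n : ℕ} (K : Set (Euc n)) : Set (Euc n) :=
  {x | ∀ y ∈ K, ⟪x, y⟫ ≤ 1}

/-- An ellipsoid in `ℝⁿ`: the image of the unit ball under an invertible affine map. -/
def IsEllipsoid {n : ℕ} (E : Set (Euc n)) : Prop :=
  ∃ (c : Euc n) (T : Euc n ≃ₗ[ℝ] Euc n),
    E = (fun x => c + T x) '' closedBall (0 : Euc n) 1

/-- The volume ratio `vr(L) = inf {(|L|/|E|)^{1/n} : E an ellipsoid, E ⊆ L}`. -/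
def vr (n : ℕ) (L : Set (Euc n)) : ℝ :=
  sInf {r : ℝ | ∃ E : Set (Euc n), IsEllipsoid E ∧ E ⊆ L ∧
    r = ((volume L).toReal / (volume E).toReal) ^ ((1 : ℝ) / n)}

section Fibers

open scoped Pointwise

variable {E : Type*} [NormedAddCommGroup E] [InnerProductSpace ℝ E] [FiniteDimensional ℝ E]
  [MeasurableSpace E] [BorelSpace E]

/-- The intersection of `S` with the line through `w` in direction `u`, as a set of reals. -/
def lineFiber (u : E) (S : Set E) (w : (ℝ ∙ u)ᗮ) : Set ℝ := {s | (w : E) + s • u ∈ S}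

omit [FiniteDimensional ℝ E] [MeasurableSpace E] [BorelSpace E] in
theorem mem_lineFiber {u : E} {S : Set E} {w : (ℝ ∙ u)ᗮ} {s : ℝ} :
    s ∈ lineFiber u S w ↔ (w : E) + s • u ∈ S := Iff.rfl

omit [FiniteDimensional ℝ E] [MeasurableSpace E] [BorelSpace E] in
theorem inner_orthogonal_singleton {u : E} (w : (ℝ ∙ u)ᗮ) : ⟪(w : E), u⟫ = 0 :=
  Submodule.mem_orthogonal_singleton_iff_inner_left.1 w.2

theorem measurePreserving_add_smul {u : E} (hu : ‖u‖ = 1) :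
    MeasurePreserving (fun p : (ℝ ∙ u)ᗮ × ℝ => (p.1 : E) + p.2 • u)
      ((volume : Measure (ℝ ∙ u)ᗮ).prod (volume : Measure ℝ)) volume := by
  have h1 := (ℝ ∙ u).measurePreserving_measurableEquivProd (0 : E)
  rw [InnerProductSpace.euclideanHausdorffMeasure_eq_volume] at h1
  have h2 := h1.symm
  let e : ℝ ≃ₗᵢ[ℝ] (ℝ ∙ u) := LinearIsometryEquiv.toSpanUnitSingleton u hu
  have h3 : MeasurePreserving e volume volume := e.measurePreserving
  have h4 : MeasurePreserving (Prod.map e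
      (id : (ℝ ∙ u)ᗮ → (ℝ ∙ u)ᗮ)) ((volume : Measure ℝ).prod volume) (volume.prod volume) :=
    h3.prod (MeasurePreserving.id _)
  have h5 := (h2.comp h4).comp (Measure.measurePreserving_swap
    (μ := (volume : Measure (ℝ ∙ u)ᗮ)) (ν := (volume : Measure ℝ)))
  have hfun : (fun p : (ℝ ∙ u)ᗮ × ℝ => (p.1 : E) + p.2 • u) =
      (((ℝ ∙ u).measurableEquivProd (0 : E)).symm ∘ Prod.map e id) ∘ Prod.swap := by
    ext p
    simp [e, add_comm]
  rw [hfun]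
  exact h5

theorem lintegral_eq_lintegral_line {u : E} (hu : ‖u‖ = 1) {f : E → ℝ≥0∞} (hf : Measurable f) :
    ∫⁻ x, f x = ∫⁻ w : (ℝ ∙ u)ᗮ, ∫⁻ s : ℝ, f (w + s • u) := by
  have h := measurePreserving_add_smul hu
  exact (h.lintegral_comp hf).symm.trans
    (lintegral_prod _ (hf.comp h.measurable).aemeasurable)

theorem volume_eq_lintegral_lineFiber {u : E} (hu : ‖u‖ = 1) {S : Set E} (hS : MeasurableSet S) :
    volume S = ∫⁻ w : (ℝ ∙ u)ᗮ, volume (lineFiber u S w) := by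
  have h := measurePreserving_add_smul hu
  rw [← h.measure_preimage hS.nullMeasurableSet, Measure.prod_apply (h.measurable hS)]
  rfl

theorem measurable_volume_lineFiber {u : E} (hu : ‖u‖ = 1) {S : Set E} (hS : MeasurableSet S) :
    Measurable fun w : (ℝ ∙ u)ᗮ => volume (lineFiber u S w) :=
  measurable_measure_prodMk_left ((measurePreserving_add_smul hu).measurable hS)

omit [FiniteDimensional ℝ E] [MeasurableSpace E] [BorelSpace E] in
theorem isCompact_lineFiber {u : E} (hu : ‖u‖ = 1) {S : Set E} (hS : IsCompact S)
    (w : (ℝ ∙ u)ᗮ) : IsCompact (lineFiber u S w) := by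
  have : Isometry (fun s : ℝ => (w : E) + s • u) := by
    refine Isometry.of_dist_eq fun s t => ?_
    rw [dist_add_left, dist_eq_norm, ← sub_smul, norm_smul, hu, mul_one, dist_eq_norm]
  exact this.isClosedEmbedding.isCompact_preimage hS

omit [FiniteDimensional ℝ E] [MeasurableSpace E] [BorelSpace E] in
theorem ordConnected_lineFiber {u : E} {S : Set E} (hS : Convex ℝ S)
    (w : (ℝ ∙ u)ᗮ) : (lineFiber u S w).OrdConnected := by
  refine Convex.ordConnected fun s hs t ht a b ha hb hab => ?_
  have := hS hs ht ha hb hab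
  rw [mem_lineFiber]
  convert this using 1
  simp only [smul_add, smul_smul, smul_eq_mul, add_smul]
  have : (w : E) = a • (w : E) + b • (w : E) := by rw [← add_smul, hab, one_smul]
  nth_rewrite 1 [this]
  abel

theorem eq_Icc_of_isCompact_ordConnected {F : Set ℝ} (hF : IsCompact F) (hc : F.OrdConnected)
    (hne : F.Nonempty) : ∃ a b : ℝ, a ≤ b ∧ F = Icc a b := by
  refine ⟨sInf F, sSup F, Real.sInf_le_sSup F hF.bddBelow hF.bddAbove, ?_⟩
  exact eq_Icc_of_connected_compact ⟨hne, hc.isPreconnected⟩ hF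

/-- The set of base points `w` of lines `w + ℝ u` that meet `S`. -/
def lineShadow (u : E) (S : Set E) : Set (ℝ ∙ u)ᗮ := {w | (lineFiber u S w).Nonempty}

omit [FiniteDimensional ℝ E] [MeasurableSpace E] [BorelSpace E] in
theorem exists_eq_add_smul (u x : E) : ∃ (w : (ℝ ∙ u)ᗮ) (s : ℝ), x = w + s • u := by
  obtain ⟨y, hy, z, hz, h⟩ := (ℝ ∙ u).exists_add_mem_mem_orthogonal x
  obtain ⟨s, rfl⟩ := Submodule.mem_span_singleton.1 hy
  exact ⟨⟨z, hz⟩, s, by rw [h, add_comm]⟩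

omit [FiniteDimensional ℝ E] [MeasurableSpace E] [BorelSpace E] in
theorem coe_image_lineShadow {u : E} (hu : ‖u‖ = 1) (S : Set E) :
    ((↑) : (ℝ ∙ u)ᗮ → E) '' lineShadow u S = (fun x => x - ⟪x, u⟫ • u) '' S := by
  have key : ∀ (w : (ℝ ∙ u)ᗮ) (s : ℝ), ⟪(w : E) + s • u, u⟫ = s := by
    intro w s
    rw [inner_add_left, inner_smul_left, real_inner_self_eq_norm_sq, hu,
      inner_orthogonal_singleton]
    simp
  ext x
  constructor
  · rintro ⟨w, ⟨s, hs⟩, rfl⟩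
    refine ⟨_, hs, ?_⟩
    simp only [key]
    abel
  · rintro ⟨y, hy, rfl⟩
    obtain ⟨w, s, rfl⟩ := exists_eq_add_smul u y
    refine ⟨w, ⟨s, hy⟩, ?_⟩
    simp only [key]
    abel

omit [FiniteDimensional ℝ E] [MeasurableSpace E] [BorelSpace E] in
theorem isCompact_lineShadow {u : E} (hu : ‖u‖ = 1) {S : Set E} (hS : IsCompact S) :
    IsCompact (lineShadow u S) := by
  rw [Subtype.isCompact_iff, coe_image_lineShadow hu]
  exact hS.image (by fun_prop)

omit [MeasurableSpace E] [BorelSpace E] [FiniteDimensional ℝ E] in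
theorem lineShadow_mono (u : E) {S T : Set E} (h : S ⊆ T) : lineShadow u S ⊆ lineShadow u T :=
  fun _ ⟨s, hs⟩ => ⟨s, h hs⟩

omit [FiniteDimensional ℝ E] [MeasurableSpace E] [BorelSpace E] in
theorem isCompact_segment (x y : E) : IsCompact (segment ℝ x y) := by
  rw [segment_eq_image_lineMap]
  exact isCompact_Icc.image (AffineMap.lineMap_continuous)

omit [FiniteDimensional ℝ E] [MeasurableSpace E] [BorelSpace E] in
theorem mem_add_segment {K : Set E} {x z : E} :
    z ∈ K + segment ℝ 0 x ↔ ∃ k ∈ K, ∃ t ∈ Icc (0 : ℝ) 1, z = k + t • x := by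
  rw [segment_eq_image, mem_add]
  constructor
  · rintro ⟨k, hk, _, ⟨t, ht, rfl⟩, rfl⟩
    exact ⟨k, hk, t, ht, by simp⟩
  · rintro ⟨k, hk, t, ht, rfl⟩
    exact ⟨k, hk, _, ⟨t, ht, rfl⟩, by simp⟩

theorem volume_add_segment {u : E} (hu : ‖u‖ = 1) {K : Set E} (hK : Convex ℝ K)
    (hc : IsCompact K) {r : ℝ} (hr : 0 ≤ r) :
    volume (K + segment ℝ 0 (r • u)) = volume K + ENNReal.ofReal r * volume (lineShadow u K) := by
  rw [volume_eq_lintegral_lineFiber hu (hc.add (isCompact_segment _ _)).measurableSet,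
    volume_eq_lintegral_lineFiber hu hc.measurableSet,
    ← lintegral_indicator_const (isCompact_lineShadow hu hc).measurableSet,
    ← lintegral_add_left (measurable_volume_lineFiber hu hc.measurableSet)]
  refine lintegral_congr fun w => ?_
  have hfib : lineFiber u (K + segment ℝ 0 (r • u)) w = lineFiber u K w + Icc 0 r := by
    ext s
    rw [mem_lineFiber, mem_add_segment, mem_add]
    constructor
    · rintro ⟨k, hk, t, ht, h⟩
      refine ⟨s - t * r, ?_, t * r, ⟨mul_nonneg ht.1 hr, by nlinarith [ht.2]⟩, by ring⟩
      rw [mem_lineFiber]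
      convert hk using 1
      rw [sub_smul, ← add_sub_assoc, h, smul_smul]
      abel
    · rintro ⟨a, ha, b, hb, rfl⟩
      rcases hr.eq_or_lt with rfl | hr'
      · refine ⟨_, ha, 0, by simp, ?_⟩
        have : b = 0 := le_antisymm hb.2 hb.1
        simp [this]
      · refine ⟨_, ha, b / r, ⟨by have := hb.1; positivity, (div_le_one hr').2 hb.2⟩, ?_⟩
        rw [smul_smul, div_mul_cancel₀ _ hr'.ne', add_smul]
        abel
  rw [hfib]
  by_cases hw : w ∈ lineShadow u K
  · obtain ⟨a, b, hab, h⟩ := eq_Icc_of_isCompact_ordConnected (isCompact_lineFiber hu hc w)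
      (ordConnected_lineFiber hK w) hw
    rw [h, indicator_of_mem hw, Icc_add_Icc hab hr, Real.volume_Icc, Real.volume_Icc,
      ← ENNReal.ofReal_add (by linarith) hr]
    ring_nf
  · rw [indicator_of_notMem hw]
    have : lineFiber u K w = ∅ := not_nonempty_iff_eq_empty.1 hw
    simp [this]

theorem volume_le_of_half_diff_mem {F G : Set ℝ} (hF : IsCompact F) (hG : G.OrdConnected)
    (h : ∀ s ∈ F, ∀ t ∈ F, (s - t) / 2 ∈ G) : volume F ≤ volume G := by
  rcases F.eq_empty_or_nonempty with rfl | hne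
  · simp
  have h1 := hF.sInf_mem hne
  have h2 := hF.sSup_mem hne
  have hsub : F ⊆ Icc (sInf F) (sSup F) := subset_Icc_csInf_csSup hF.bddBelow hF.bddAbove
  have hGsub : Icc ((sInf F - sSup F) / 2) ((sSup F - sInf F) / 2) ⊆ G :=
    hG.out (h _ h1 _ h2) (h _ h2 _ h1)
  calc volume F ≤ volume (Icc (sInf F) (sSup F)) := measure_mono hsub
    _ = volume (Icc ((sInf F - sSup F) / 2) ((sSup F - sInf F) / 2)) := by
      rw [Real.volume_Icc, Real.volume_Icc]; ring_nf
    _ ≤ volume G := measure_mono hGsub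

theorem volume_le_of_mem_average {A B C : Set ℝ} {a b : ℝ} (ha : 0 ≤ a) (hb : 0 ≤ b)
    (hA : IsCompact A) (hA' : A.OrdConnected) (hB : IsCompact B) (hB' : B.OrdConnected)
    (h : ∀ s ∈ C, ∃ x ∈ A, ∃ y ∈ B, s = a * x + b * y) :
    volume C ≤ ENNReal.ofReal a * volume A + ENNReal.ofReal b * volume B := by
  rcases C.eq_empty_or_nonempty with rfl | ⟨s, hs⟩
  · simp
  obtain ⟨x, hx, y, hy, -⟩ := h s hs
  obtain ⟨a1, a2, ha12, rfl⟩ := eq_Icc_of_isCompact_ordConnected hA hA' ⟨x, hx⟩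
  obtain ⟨b1, b2, hb12, rfl⟩ := eq_Icc_of_isCompact_ordConnected hB hB' ⟨y, hy⟩
  have hsub : C ⊆ Icc (a * a1 + b * b1) (a * a2 + b * b2) := by
    intro s hs
    obtain ⟨x, hx, y, hy, rfl⟩ := h s hs
    have := mul_le_mul_of_nonneg_left hx.1 ha
    have := mul_le_mul_of_nonneg_left hx.2 ha
    have := mul_le_mul_of_nonneg_left hy.1 hb
    have := mul_le_mul_of_nonneg_left hy.2 hb
    constructor <;> linarith
  refine (measure_mono hsub).trans_eq ?_
  rw [Real.volume_Icc, Real.volume_Icc, Real.volume_Icc, ← ENNReal.ofReal_mul ha,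
    ← ENNReal.ofReal_mul hb, ← ENNReal.ofReal_add]
  · ring_nf
  · exact mul_nonneg ha (by linarith)
  · exact mul_nonneg hb (by linarith)

theorem volume_le_of_mem_line_average {u : E} (hu : ‖u‖ = 1) {A B C : Set E} {a b : ℝ}
    (ha : 0 ≤ a) (hb : 0 ≤ b) (hab : a + b = 1)
    (hA : Convex ℝ A) (hA' : IsCompact A) (hB : Convex ℝ B) (hB' : IsCompact B)
    (hC : MeasurableSet C)
    (h : ∀ z ∈ C, ∃ x ∈ A, ∃ y ∈ B, (∃ c : ℝ, x - y = c • u) ∧ z = a • x + b • y) :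
    volume C ≤ ENNReal.ofReal a * volume A + ENNReal.ofReal b * volume B := by
  rw [volume_eq_lintegral_lineFiber hu hC, volume_eq_lintegral_lineFiber hu hA'.measurableSet,
    volume_eq_lintegral_lineFiber hu hB'.measurableSet,
    ← lintegral_const_mul _ (measurable_volume_lineFiber hu hA'.measurableSet),
    ← lintegral_const_mul _ (measurable_volume_lineFiber hu hB'.measurableSet),
    ← lintegral_add_left ((measurable_volume_lineFiber hu hA'.measurableSet).const_mul _)]
  refine lintegral_mono fun w => ?_
  refine volume_le_of_mem_average ha hb (isCompact_lineFiber hu hA' w)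
    (ordConnected_lineFiber hA w) (isCompact_lineFiber hu hB' w) (ordConnected_lineFiber hB w) ?_
  intro s hs
  obtain ⟨x, hx, y, hy, ⟨c, hc⟩, hz⟩ := h _ hs
  obtain rfl : a = 1 - b := by linarith
  have hx' : x = w + (s + b * c) • u := by
    have : x = ((1 - b) • x + b • y) + b • (x - y) := by module
    rw [this, ← hz, hc]; module
  have hy' : y = w + (s - (1 - b) * c) • u := by
    have : y = ((1 - b) • x + b • y) - (1 - b) • (x - y) := by module
    rw [this, ← hz, hc]; module
  refine ⟨s + b * c, ?_, s - (1 - b) * c, ?_, by ring⟩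
  · rw [mem_lineFiber, ← hx']; exact hx
  · rw [mem_lineFiber, ← hy']; exact hy

/-- Reflection in the hyperplane orthogonal to `u`. -/
abbrev hypRefl (u : E) : E ≃ₗᵢ[ℝ] E := (ℝ ∙ u)ᗮ.reflection

omit [FiniteDimensional ℝ E] [MeasurableSpace E] [BorelSpace E] in
theorem hypRefl_add_smul (u : E) (w : (ℝ ∙ u)ᗮ) (s : ℝ) :
    hypRefl u (w + s • u) = w - s • u := by
  rw [map_add, map_smul, Submodule.reflection_orthogonalComplement_singleton_eq_neg,
    Submodule.reflection_mem_subspace_eq_self w.2]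
  simp [sub_eq_add_neg]

omit [FiniteDimensional ℝ E] [MeasurableSpace E] [BorelSpace E] in
theorem half_smul_add_hypRefl (u : E) (w : (ℝ ∙ u)ᗮ) (s t : ℝ) :
    (1 / 2 : ℝ) • ((w + s • u) + hypRefl u (w + t • u)) = w + ((s - t) / 2) • u := by
  rw [hypRefl_add_smul]; module

/-- If `B` contains all Steiner averages of points of `A` in direction `u`, it is at least as
large as `A`. -/
theorem volume_le_of_steiner_mem {u : E} (hu : ‖u‖ = 1) {A B : Set E} (hA : IsCompact A)
    (hB : Convex ℝ B) (hB' : MeasurableSet B)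
    (h : ∀ x ∈ A, ∀ y ∈ A, (∃ c : ℝ, x - y = c • u) → (1 / 2 : ℝ) • (x + hypRefl u y) ∈ B) :
    volume A ≤ volume B := by
  rw [volume_eq_lintegral_lineFiber hu hA.measurableSet, volume_eq_lintegral_lineFiber hu hB']
  refine lintegral_mono fun w => volume_le_of_half_diff_mem (isCompact_lineFiber hu hA w)
    (ordConnected_lineFiber hB w) fun s hs t ht => ?_
  rw [mem_lineFiber, ← half_smul_add_hypRefl]
  exact h _ hs _ ht ⟨s - t, by module⟩

end Fibers

section ProjNorm

open scoped Pointwise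

variable {E : Type*} [NormedAddCommGroup E] [InnerProductSpace ℝ E] [FiniteDimensional ℝ E]
  [MeasurableSpace E] [BorelSpace E]

/-- The increase of volume of `K` under Minkowski addition of the segment `[0, x]`. For convex `K`
and a unit vector `x`, this is the volume of the projection of `K` to the hyperplane `xᗮ`. -/
def projNorm (K : Set E) (x : E) : ℝ := volume.real (K + segment ℝ 0 x) - volume.real K

omit [FiniteDimensional ℝ E] [MeasurableSpace E] [BorelSpace E] in
theorem exists_eq_smul_unit {x : E} (hx : x ≠ 0) : ∃ u : E, ‖u‖ = 1 ∧ x = ‖x‖ • u :=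
  ⟨‖x‖⁻¹ • x, norm_smul_inv_norm hx, by rw [smul_smul, mul_inv_cancel₀ (norm_ne_zero_iff.2 hx),
    one_smul]⟩

variable {K : Set E}

@[simp] theorem projNorm_zero (K : Set E) : projNorm K 0 = 0 := by
  simp [projNorm]

theorem projNorm_smul_unit (hK : Convex ℝ K) (hc : IsCompact K) {u : E} (hu : ‖u‖ = 1) {r : ℝ}
    (hr : 0 ≤ r) : projNorm K (r • u) = r * volume.real (lineShadow u K) := by
  rw [projNorm, Measure.real, volume_add_segment hu hK hc hr, ENNReal.toReal_add hc.measure_ne_top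
    (ENNReal.mul_ne_top ENNReal.ofReal_ne_top (isCompact_lineShadow hu hc).measure_ne_top),
    ENNReal.toReal_mul, ENNReal.toReal_ofReal hr, Measure.real, Measure.real]
  ring

theorem projNorm_unit (hK : Convex ℝ K) (hc : IsCompact K) {u : E} (hu : ‖u‖ = 1) :
    projNorm K u = volume.real (lineShadow u K) := by
  simpa using projNorm_smul_unit hK hc hu zero_le_one

theorem projNorm_smul (hK : Convex ℝ K) (hc : IsCompact K) {r : ℝ} (hr : 0 ≤ r) (x : E) :
    projNorm K (r • x) = r * projNorm K x := by
  rcases eq_or_ne x 0 with rfl | hx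
  · simp
  · obtain ⟨u, hu, h⟩ := exists_eq_smul_unit hx
    rw [h, smul_smul, projNorm_smul_unit hK hc hu (mul_nonneg hr (norm_nonneg _)),
      projNorm_smul_unit hK hc hu (norm_nonneg _), mul_assoc]

theorem projNorm_mono {L : Set E} (hK : Convex ℝ K) (hc : IsCompact K) (hL : Convex ℝ L)
    (hLc : IsCompact L) (h : K ⊆ L) (x : E) : projNorm K x ≤ projNorm L x := by
  rcases eq_or_ne x 0 with rfl | hx
  · simp
  · obtain ⟨u, hu, hxu⟩ := exists_eq_smul_unit hx
    rw [hxu, projNorm_smul_unit hK hc hu (norm_nonneg _),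
      projNorm_smul_unit hL hLc hu (norm_nonneg _)]
    exact mul_le_mul_of_nonneg_left (measureReal_mono (lineShadow_mono u h)
      (isCompact_lineShadow hu hLc).measure_ne_top) (norm_nonneg _)

theorem projNorm_nonneg (hK : Convex ℝ K) (hc : IsCompact K) (x : E) : 0 ≤ projNorm K x := by
  rcases eq_or_ne x 0 with rfl | hx
  · simp
  · obtain ⟨u, hu, hxu⟩ := exists_eq_smul_unit hx
    rw [hxu, projNorm_smul_unit hK hc hu (norm_nonneg _)]
    positivity

theorem projNorm_add_left (K : Set E) (c x : E) : projNorm ((c + ·) '' K) x = projNorm K x := by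
  have h : ((c + ·) '' K) + segment ℝ 0 x = (c + ·) '' (K + segment ℝ 0 x) := by
    simp only [← singleton_add, add_assoc]
  rw [projNorm, h, Measure.real, Measure.real, image_add_left, image_add_left,
    measure_preimage_add, measure_preimage_add]
  rfl

theorem projNorm_image (K : Set E) (T : E ≃ₗ[ℝ] E) (x : E) :
    projNorm (T '' K) (T x) = |LinearMap.det (T : E →ₗ[ℝ] E)| * projNorm K x := by
  have h : T '' K + segment ℝ 0 (T x) = (T : E →ₗ[ℝ] E) '' (K + segment ℝ 0 x) := by
    rw [image_add]
    congr 1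
    have := image_segment ℝ (T : E →ₗ[ℝ] E).toAffineMap 0 x
    simpa using this.symm
  have h2 : T '' K = (T : E →ₗ[ℝ] E) '' K := rfl
  rw [projNorm, h, h2, Measure.real, Measure.real, Measure.addHaar_image_linearMap,
    Measure.addHaar_image_linearMap, ENNReal.toReal_mul, ENNReal.toReal_mul,
    ENNReal.toReal_ofReal (abs_nonneg _), projNorm, Measure.real, Measure.real]
  ring

theorem projNorm_isometry (K : Set E) (T : E ≃ₗᵢ[ℝ] E) (x : E) :
    projNorm (T '' K) (T x) = projNorm K x := by
  have hvol : ∀ S : Set E, volume (T '' S) = volume S := fun S => by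
    rw [T.image_eq_preimage_symm]
    exact T.symm.measurePreserving.measure_preimage_equiv (f := T.symm.toMeasurableEquiv) S
  have h : T '' K + segment ℝ 0 (T x) = T '' (K + segment ℝ 0 x) := by
    rw [image_add]
    congr 1
    have := image_segment ℝ (T.toLinearEquiv : E →ₗ[ℝ] E).toAffineMap 0 x
    simpa using this.symm
  rw [projNorm, h, Measure.real, Measure.real, hvol, hvol]
  rfl

theorem projNorm_smul_set (hK : Convex ℝ K) (hc : IsCompact K) {r : ℝ} (hr : 0 < r) (x : E) :
    r * projNorm (r • K) x = r ^ Module.finrank ℝ E * projNorm K x := by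
  have h := projNorm_image K (LinearEquiv.smulOfNeZero ℝ E r hr.ne') x
  have h1 : (LinearEquiv.smulOfNeZero ℝ E r hr.ne' : E →ₗ[ℝ] E) = r • LinearMap.id := by
    ext; simp
  rw [h1, LinearMap.det_smul, LinearMap.det_id, mul_one, abs_of_pos (by positivity)] at h
  rw [← h, ← projNorm_smul (hK.smul r) (hc.smul r) hr.le]
  rfl

theorem projNorm_smul_add_smul_le (hK : Convex ℝ K) (hc : IsCompact K) (x y : E) {a b : ℝ}
    (ha : 0 ≤ a) (hb : 0 ≤ b) (hab : a + b = 1) :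
    projNorm K (a • x + b • y) ≤ a * projNorm K x + b * projNorm K y := by
  rcases eq_or_ne (x - y) 0 with h | h
  · obtain rfl := sub_eq_zero.1 h
    rw [← add_smul, ← add_mul, hab, one_smul, one_mul]
  obtain ⟨u, hu, hxu⟩ := exists_eq_smul_unit h
  have key := volume_le_of_mem_line_average hu ha hb hab (A := K + segment ℝ 0 x)
    (B := K + segment ℝ 0 y) (C := K + segment ℝ 0 (a • x + b • y))
    (hK.add (convex_segment _ _)) (hc.add (isCompact_segment _ _))
    (hK.add (convex_segment _ _)) (hc.add (isCompact_segment _ _))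
    (hc.add (isCompact_segment _ _)).measurableSet ?_
  · have hfin : ∀ z, volume (K + segment ℝ 0 z) ≠ ∞ := fun z =>
      (hc.add (isCompact_segment _ _)).measure_ne_top
    have := ENNReal.toReal_mono (by finiteness [hfin x, hfin y]) key
    rw [ENNReal.toReal_add (by finiteness [hfin x]) (by finiteness [hfin y]), ENNReal.toReal_mul,
      ENNReal.toReal_mul, ENNReal.toReal_ofReal ha, ENNReal.toReal_ofReal hb] at this
    simp only [projNorm, Measure.real]
    obtain rfl : a = 1 - b := by linarith
    linarith
  · intro z hz
    obtain ⟨k, hk, t, ht, rfl⟩ := mem_add_segment.1 hz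
    refine ⟨k + t • x, mem_add_segment.2 ⟨k, hk, t, ht, rfl⟩, k + t • y,
      mem_add_segment.2 ⟨k, hk, t, ht, rfl⟩, ⟨t * ‖x - y‖, ?_⟩, ?_⟩
    · rw [mul_smul, ← hxu]; module
    · obtain rfl : a = 1 - b := by linarith
      module

theorem convexOn_projNorm (hK : Convex ℝ K) (hc : IsCompact K) :
    ConvexOn ℝ univ (projNorm K) :=
  ⟨convex_univ, fun x _ y _ _ _ ha hb hab => projNorm_smul_add_smul_le hK hc x y ha hb hab⟩

theorem continuous_projNorm (hK : Convex ℝ K) (hc : IsCompact K) : Continuous (projNorm K) :=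
  (convexOn_projNorm hK hc).locallyLipschitz.continuous

/-- The polar projection body of `K`. -/
def polarProj (K : Set E) : Set E := {x | projNorm K x ≤ 1}

theorem convex_polarProj (hK : Convex ℝ K) (hc : IsCompact K) : Convex ℝ (polarProj K) := by
  simpa [polarProj] using (convexOn_projNorm hK hc).convex_le 1

theorem isClosed_polarProj (hK : Convex ℝ K) (hc : IsCompact K) : IsClosed (polarProj K) :=
  isClosed_le (continuous_projNorm hK hc) continuous_const

theorem polarProj_anti {L : Set E} (hK : Convex ℝ K) (hc : IsCompact K) (hL : Convex ℝ L)
    (hLc : IsCompact L) (h : K ⊆ L) : polarProj L ⊆ polarProj K :=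
  fun x hx => (projNorm_mono hK hc hL hLc h x).trans hx

theorem projNorm_closedBall_unit {u v : E} (hu : ‖u‖ = 1) (hv : ‖v‖ = 1) (r : ℝ) :
    projNorm (closedBall (0 : E) r) u = projNorm (closedBall (0 : E) r) v := by
  have h1 : (ℝ ∙ (u - v))ᗮ.reflection u = v := Submodule.reflection_sub (by rw [hu, hv])
  rw [← projNorm_isometry _ (ℝ ∙ (u - v))ᗮ.reflection, h1]
  simp

theorem projNorm_unitBall_pos {u : E} (hu : ‖u‖ = 1) : 0 < projNorm (closedBall (0 : E) 1) u := by
  rw [projNorm_unit (convex_closedBall _ _) (isCompact_closedBall _ _) hu]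
  have hsub : closedBall (0 : (ℝ ∙ u)ᗮ) 1 ⊆ lineShadow u (closedBall (0 : E) 1) := by
    intro w hw
    refine ⟨0, ?_⟩
    simpa [mem_lineFiber] using hw
  refine ENNReal.toReal_pos (ne_of_gt (lt_of_lt_of_le ?_ (measure_mono hsub)))
    (isCompact_lineShadow hu (isCompact_closedBall _ _)).measure_ne_top
  exact measure_closedBall_pos _ _ one_pos

theorem projNorm_pos (hK : Convex ℝ K) (hc : IsCompact K) (hi : (interior K).Nonempty) {x : E}
    (hx : x ≠ 0) : 0 < projNorm K x := by
  obtain ⟨c, hcK⟩ := hi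
  obtain ⟨r, hr, hball⟩ := nhds_basis_closedBall.mem_iff.1 (mem_interior_iff_mem_nhds.1 hcK)
  obtain ⟨u, hu, hxu⟩ := exists_eq_smul_unit hx
  have h1 : closedBall c r = (c + ·) '' (r • closedBall (0 : E) 1) := by
    rw [smul_unitClosedBall_of_nonneg hr.le]
    simp
  refine lt_of_lt_of_le ?_ (projNorm_mono (convex_closedBall c r) (isCompact_closedBall c r) hK hc
    hball x)
  rw [h1, projNorm_add_left, hxu, projNorm_smul (by
    exact (convex_closedBall _ _).smul r) ((isCompact_closedBall _ _).smul r) (norm_nonneg _)]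
  refine mul_pos (norm_pos_iff.2 hx) (pos_of_mul_pos_right (a := r) ?_ hr.le)
  rw [projNorm_smul_set (convex_closedBall _ _) (isCompact_closedBall _ _) hr]
  exact mul_pos (by positivity) (projNorm_unitBall_pos hu)

theorem isCompact_polarProj (hK : Convex ℝ K) (hc : IsCompact K) (hi : (interior K).Nonempty) :
    IsCompact (polarProj K) := by
  refine isCompact_of_isClosed_isBounded (isClosed_polarProj hK hc) ?_
  rcases (sphere (0 : E) 1).eq_empty_or_nonempty with h | h
  · have : ∀ x : E, x = 0 := by
      intro x
      by_contra hx
      obtain ⟨u, hu, -⟩ := exists_eq_smul_unit hx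
      have : u ∈ sphere (0 : E) 1 := by simpa using hu
      simp [h] at this
    exact (Bornology.isBounded_singleton (x := (0 : E))).subset fun x _ => this x
  · obtain ⟨v, hv, hmin⟩ := (isCompact_sphere (0 : E) 1).exists_isMinOn h
      (continuous_projNorm hK hc).continuousOn
    have hv0 : v ≠ 0 := by
      rintro rfl
      simp at hv
    have hpos := projNorm_pos hK hc hi hv0
    refine isBounded_iff_forall_norm_le.2 ⟨(projNorm K v)⁻¹, fun x hx => ?_⟩
    rcases eq_or_ne x 0 with rfl | hx0
    · simp [hpos.le]
    obtain ⟨u, hu, hxu⟩ := exists_eq_smul_unit hx0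
    have h1 : projNorm K v ≤ projNorm K u := hmin (by simpa using hu)
    have h2 : projNorm K x ≤ 1 := hx
    rw [hxu, projNorm_smul hK hc (norm_nonneg _)] at h2
    rw [← one_div, le_div_iff₀ hpos]
    exact (mul_le_mul_of_nonneg_left h1 (norm_nonneg _)).trans h2

end ProjNorm

section Compactness

open scoped Pointwise Topology
open TopologicalSpace

variable {E : Type*} [NormedAddCommGroup E] [InnerProductSpace ℝ E] [FiniteDimensional ℝ E]
  [MeasurableSpace E] [BorelSpace E]

theorem exists_mem_dist_lt_of_dist_lt {X : Type*} [MetricSpace X] {M N : NonemptyCompacts X}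
    {δ : ℝ} (h : dist M N < δ) {x : X} (hx : x ∈ M) : ∃ y ∈ N, dist x y < δ := by
  rw [NonemptyCompacts.dist_eq] at h
  exact exists_dist_lt_of_hausdorffDist_lt hx h (hausdorffEDist_ne_top_of_nonempty_of_bounded
    M.nonempty N.nonempty M.isCompact.isBounded N.isCompact.isBounded)

theorem upperSemicontinuous_measure_nonemptyCompacts {X : Type*} [MetricSpace X] [ProperSpace X]
    [MeasurableSpace X] [OpensMeasurableSpace X] (ν : Measure X)
    [IsFiniteMeasureOnCompacts ν] :
    UpperSemicontinuous fun M : NonemptyCompacts X => ν M := by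
  intro M y hy
  have h1 := tendsto_measure_cthickening_of_isCompact (μ := ν) M.isCompact
  have h2 : ∀ᶠ r in 𝓝[>] (0 : ℝ), ν (cthickening r (M : Set X)) < y :=
    (h1.mono_left nhdsWithin_le_nhds).eventually (gt_mem_nhds hy)
  obtain ⟨δ, hδ, hδ0⟩ := (h2.and self_mem_nhdsWithin).exists
  filter_upwards [ball_mem_nhds M hδ0] with N hN
  refine (measure_mono fun x hx => ?_).trans_lt hδ
  obtain ⟨z, hz, hxz⟩ := exists_mem_dist_lt_of_dist_lt (mem_ball.1 hN) hx
  exact mem_cthickening_of_dist_le x z δ _ hz hxz.le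

omit [FiniteDimensional ℝ E] [MeasurableSpace E] [BorelSpace E] in
theorem isClosed_setOf_convex_nonemptyCompacts :
    IsClosed {M : NonemptyCompacts E | Convex ℝ (M : Set E)} := by
  refine isClosed_of_closure_subset fun M hM x hx y hy a b ha hb hab => ?_
  refine M.isCompact.isClosed.closure_subset (Metric.mem_closure_iff.2 fun ε hε => ?_)
  obtain ⟨N, hN, hMN⟩ := Metric.mem_closure_iff.1 hM (ε / 2) (half_pos hε)
  obtain ⟨x', hx', hxx'⟩ := exists_mem_dist_lt_of_dist_lt hMN hx
  obtain ⟨y', hy', hyy'⟩ := exists_mem_dist_lt_of_dist_lt hMN hy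
  obtain ⟨z, hz, hzz⟩ := exists_mem_dist_lt_of_dist_lt (dist_comm M N ▸ hMN)
    (hN hx' hy' ha hb hab : a • x' + b • y' ∈ N)
  refine ⟨z, hz, (dist_triangle _ (a • x' + b • y') _).trans_lt ?_⟩
  have : dist (a • x + b • y) (a • x' + b • y') ≤ a * dist x x' + b * dist y y' := by
    refine (dist_add_add_le _ _ _ _).trans ?_
    rw [dist_smul₀, dist_smul₀, Real.norm_of_nonneg ha, Real.norm_of_nonneg hb]
  have : a * dist x x' + b * dist y y' ≤ a * (ε / 2) + b * (ε / 2) := by gcongr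
  rw [← add_mul, hab] at this
  linarith

omit [InnerProductSpace ℝ E] [FiniteDimensional ℝ E] [MeasurableSpace E] [BorelSpace E] in
theorem isClosed_setOf_symmetric_nonemptyCompacts :
    IsClosed {M : NonemptyCompacts E | ∀ x ∈ M, -x ∈ M} := by
  refine isClosed_of_closure_subset fun M hM x hx => ?_
  refine M.isCompact.isClosed.closure_subset (Metric.mem_closure_iff.2 fun ε hε => ?_)
  obtain ⟨N, hN, hMN⟩ := Metric.mem_closure_iff.1 hM (ε / 2) (half_pos hε)
  obtain ⟨x', hx', hxx'⟩ := exists_mem_dist_lt_of_dist_lt hMN hx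
  obtain ⟨z, hz, hzz⟩ := exists_mem_dist_lt_of_dist_lt (dist_comm M N ▸ hMN) (hN x' hx')
  refine ⟨z, hz, (dist_triangle _ (-x') _).trans_lt ?_⟩
  rw [dist_neg_neg]
  linarith

omit [FiniteDimensional ℝ E] [MeasurableSpace E] [BorelSpace E] in
/-- If a convex compact set `M` is contained in `N + t M` with `0 ≤ t < 1`, the second summand can be
absorbed. -/
theorem smul_subset_of_subset_add_smul {M N : Set E} (hMc : IsCompact M) (hM0 : (0 : E) ∈ M)
    (hN : Convex ℝ N) (hNc : IsCompact N) {t : ℝ} (ht0 : 0 ≤ t) (ht : t < 1)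
    (h : M ⊆ N + t • M) : (1 - t) • M ⊆ N := by
  rintro _ ⟨m, hm, rfl⟩
  by_contra hmem
  obtain ⟨f, s, hfN, hfm⟩ := geometric_hahn_banach_closed_point hN hNc.isClosed hmem
  obtain ⟨m0, hm0, hmax⟩ := hMc.exists_isMaxOn ⟨0, hM0⟩ f.continuous.continuousOn
  obtain ⟨p, hp, _, ⟨q, hq, rfl⟩, hpq⟩ := h hm0
  obtain ⟨p', hp', _, ⟨q', hq', rfl⟩, hpq'⟩ := h hm
  have h1 : f p + t * f q = f m0 := by rw [← hpq]; simp
  have h2 : f p' + t * f q' = f m := by rw [← hpq']; simp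
  have h3 : f q ≤ f m0 := hmax hq
  have h4 : f m ≤ f m0 := hmax hm
  have h5 := hfN p hp
  simp only [map_smul, smul_eq_mul] at hfm
  have h6 : 0 ≤ f m0 := by simpa using hmax hM0
  nlinarith

omit [FiniteDimensional ℝ E] [MeasurableSpace E] [BorelSpace E] in
/-- A set `M` containing a ball around `0` is approximated from inside by nearby convex sets. -/
theorem smul_subset_of_dist_lt {M N : NonemptyCompacts E} (hN : Convex ℝ (N : Set E)) {r t : ℝ}
    (hr : 0 < r) (hM : closedBall (0 : E) r ⊆ M) (ht0 : 0 < t) (ht : t < 1)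
    (h : dist M N < t * r) : (1 - t) • (M : Set E) ⊆ N := by
  refine smul_subset_of_subset_add_smul M.isCompact (hM (mem_closedBall_self hr.le)) hN
    N.isCompact ht0.le ht fun x hx => ?_
  obtain ⟨y, hy, hxy⟩ := exists_mem_dist_lt_of_dist_lt h hx
  refine ⟨y, hy, x - y, ⟨t⁻¹ • (x - y), hM ?_, ?_⟩, by simp⟩
  · rw [mem_closedBall_zero_iff, norm_smul, Real.norm_of_nonneg (inv_nonneg.2 ht0.le),
      inv_mul_le_iff₀ ht0, ← dist_eq_norm]
    exact hxy.le
  · simp [smul_smul, ht0.ne']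

theorem polarProj_smul {K : Set E} (hK : Convex ℝ K) (hc : IsCompact K) {r : ℝ} (hr : 0 < r)
    (hd : 1 ≤ Module.finrank ℝ E) :
    polarProj (r • K) = (r ^ (Module.finrank ℝ E - 1))⁻¹ • polarProj K := by
  ext x
  have hpos : 0 < r ^ (Module.finrank ℝ E - 1) := by positivity
  rw [mem_smul_set_iff_inv_smul_mem₀ (by positivity), inv_inv]
  change projNorm _ _ ≤ 1 ↔ projNorm _ _ ≤ 1
  have h := projNorm_smul_set hK hc hr x
  obtain ⟨k, hk⟩ := Nat.exists_eq_add_of_le' hd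
  rw [hk] at h ⊢
  rw [projNorm_smul hK hc (by positivity), Nat.add_sub_cancel]
  have : projNorm (r • K) x = r ^ k * projNorm K x := by
    rw [pow_succ'] at h
    exact mul_left_cancel₀ hr.ne' (by linarith)
  rw [this]

theorem volume_polarProj_smul {K : Set E} (hK : Convex ℝ K) (hc : IsCompact K) {r : ℝ} (hr : 0 < r)
    (hd : 1 ≤ Module.finrank ℝ E) :
    volume (polarProj (r • K)) =
      ENNReal.ofReal (((r ^ (Module.finrank ℝ E - 1))⁻¹) ^ Module.finrank ℝ E) *
        volume (polarProj K) := by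
  rw [polarProj_smul hK hc hr hd, Measure.addHaar_smul, abs_of_pos (by positivity)]

omit [FiniteDimensional ℝ E] [MeasurableSpace E] [BorelSpace E] in
theorem exists_closedBall_subset_of_symmetric {M : Set E} (hM : Convex ℝ M)
    (hsym : ∀ x ∈ M, -x ∈ M) (hi : (interior M).Nonempty) :
    ∃ r > 0, closedBall (0 : E) r ⊆ M := by
  obtain ⟨c, hc⟩ := hi
  obtain ⟨r, hr, hball⟩ := nhds_basis_closedBall.mem_iff.1 (mem_interior_iff_mem_nhds.1 hc)
  refine ⟨r, hr, fun x hx => ?_⟩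
  have h1 : c + x ∈ M := hball (by simpa using hx)
  have h2 : -(c - x) ∈ M := hsym _ (hball (by simpa [dist_eq_norm] using hx))
  have := hM h1 h2 (by norm_num : (0 : ℝ) ≤ 1 / 2) (by norm_num : (0 : ℝ) ≤ 1 / 2) (by norm_num)
  convert this using 1
  module

theorem interior_nonempty_of_volume_ne_zero {M : Set E} (hM : Convex ℝ M)
    (h : volume M ≠ 0) : (interior M).Nonempty := by
  by_contra hne
  rw [not_nonempty_iff_eq_empty] at hne
  have h1 := hM.addHaar_frontier volume
  refine h (measure_mono_null (t := frontier M) ?_ h1)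
  rw [frontier, hne, sdiff_empty]
  exact subset_closure

/-- Compact convex symmetric sets in a ball with lower bounds on the volume and the volume of the
polar projection body. -/
def symmetricBodies (E : Type*) [NormedAddCommGroup E] [InnerProductSpace ℝ E]
    [FiniteDimensional ℝ E] [MeasurableSpace E] [BorelSpace E] (R : ℝ) (a b : ℝ≥0∞) :
    Set (NonemptyCompacts E) :=
  {M | (M : Set E) ⊆ closedBall 0 R ∧ Convex ℝ (M : Set E) ∧ (∀ x ∈ M, -x ∈ M) ∧
    a ≤ volume (M : Set E) ∧ b ≤ volume (polarProj (M : Set E))}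

theorem isCompact_symmetricBodies (hd : 1 ≤ Module.finrank ℝ E) (R : ℝ) {a : ℝ≥0∞} (ha : a ≠ 0)
    (b : ℝ≥0∞) : IsCompact (symmetricBodies E R a b) := by
  refine (NonemptyCompacts.isCompact_subsets_of_isCompact
    (isCompact_closedBall (0 : E) R)).of_isClosed_subset ?_ fun M hM => hM.1
  refine isClosed_of_closure_subset fun M hM => ?_
  have h1 : (M : Set E) ⊆ closedBall 0 R := by
    have := (NonemptyCompacts.isCompact_subsets_of_isCompact
      (isCompact_closedBall (0 : E) R)).isClosed.closure_subset_iff.2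
        (fun N (hN : N ∈ symmetricBodies E R a b) => hN.1)
    exact this hM
  have h2 : Convex ℝ (M : Set E) :=
    isClosed_setOf_convex_nonemptyCompacts.closure_subset_iff.2
        (fun N (hN : N ∈ symmetricBodies E R a b) => hN.2.1) hM
  have h3 : ∀ x ∈ M, -x ∈ M :=
    isClosed_setOf_symmetric_nonemptyCompacts.closure_subset_iff.2
        (fun N (hN : N ∈ symmetricBodies E R a b) => hN.2.2.1) hM
  have h4 : a ≤ volume (M : Set E) :=
    ((upperSemicontinuous_measure_nonemptyCompacts
      (volume : Measure E)).isClosed_preimage a).closure_subset_iff.2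
        (fun N (hN : N ∈ symmetricBodies E R a b) => hN.2.2.2.1) hM
  refine ⟨h1, h2, h3, h4, ?_⟩
  obtain ⟨r, hr, hball⟩ := exists_closedBall_subset_of_symmetric h2 h3
    (interior_nonempty_of_volume_ne_zero h2 (ne_bot_of_le_ne_bot ha h4))
  have key : ∀ t ∈ Ioo (0 : ℝ) 1, b ≤ ENNReal.ofReal
      ((((1 - t) ^ (Module.finrank ℝ E - 1))⁻¹) ^ Module.finrank ℝ E) *
        volume (polarProj (M : Set E)) := by
    intro t ht
    obtain ⟨N, hN, hMN⟩ := Metric.mem_closure_iff.1 hM (t * r) (mul_pos ht.1 hr)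
    have hsub := smul_subset_of_dist_lt hN.2.1 hr hball ht.1 ht.2 hMN
    rw [← volume_polarProj_smul h2 M.isCompact (by linarith [ht.2]) hd]
    exact hN.2.2.2.2.trans (measure_mono (polarProj_anti (h2.smul _) (M.isCompact.smul _)
      hN.2.1 N.isCompact hsub))
  have hlim : Filter.Tendsto (fun t : ℝ => ENNReal.ofReal
      ((((1 - t) ^ (Module.finrank ℝ E - 1))⁻¹) ^ Module.finrank ℝ E) *
        volume (polarProj (M : Set E))) (𝓝[>] 0) (𝓝 (1 * volume (polarProj (M : Set E)))) := by
    refine ENNReal.Tendsto.mul_const ?_ (Or.inl one_ne_zero)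
    refine Filter.Tendsto.mono_left ?_ nhdsWithin_le_nhds
    have hc : ContinuousAt (fun t : ℝ => ENNReal.ofReal
      ((((1 - t) ^ (Module.finrank ℝ E - 1))⁻¹) ^ Module.finrank ℝ E)) 0 := by
      refine ENNReal.continuous_ofReal.continuousAt.comp (ContinuousAt.pow
        (ContinuousAt.inv₀ (by fun_prop) (by simp)) _)
    simpa [ContinuousAt] using hc
  rw [one_mul] at hlim
  exact ge_of_tendsto hlim (by
    filter_upwards [Ioo_mem_nhdsGT (zero_lt_one' ℝ)] with t ht using key t ht)

end Compactness

section Steiner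

open scoped Pointwise

variable {E : Type*} [NormedAddCommGroup E] [InnerProductSpace ℝ E] [FiniteDimensional ℝ E]
  [MeasurableSpace E] [BorelSpace E]

/-- The Steiner symmetral of `K` in direction `u` (for convex `K`). -/
def steiner (u : E) (K : Set E) : Set E :=
  (fun p : E × E => (1 / 2 : ℝ) • (p.1 + hypRefl u p.2)) ''
    ((K ×ˢ K) ∩ {p | p.1 - p.2 ∈ ℝ ∙ u})

variable {u : E} {K : Set E}

omit [FiniteDimensional ℝ E] [MeasurableSpace E] [BorelSpace E] in
theorem mem_steiner {x y : E} (hx : x ∈ K) (hy : y ∈ K) (h : x - y ∈ ℝ ∙ u) :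
    (1 / 2 : ℝ) • (x + hypRefl u y) ∈ steiner u K :=
  ⟨(x, y), ⟨⟨hx, hy⟩, h⟩, rfl⟩

omit [FiniteDimensional ℝ E] [MeasurableSpace E] [BorelSpace E] in
theorem isCompact_steiner (hc : IsCompact K) : IsCompact (steiner u K) := by
  refine ((hc.prod hc).inter_right ?_).image (by fun_prop)
  exact (ℝ ∙ u).closed_of_finiteDimensional.preimage (by fun_prop)

omit [FiniteDimensional ℝ E] [MeasurableSpace E] [BorelSpace E] in
theorem convex_steiner (hK : Convex ℝ K) : Convex ℝ (steiner u K) := by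
  rintro _ ⟨⟨x, y⟩, ⟨⟨hx, hy⟩, hxy⟩, rfl⟩ _ ⟨⟨x', y'⟩, ⟨⟨hx', hy'⟩, hxy'⟩, rfl⟩ a b ha hb hab
  have h : (a • x + b • x') - (a • y + b • y') ∈ ℝ ∙ u := by
    have : (a • x + b • x') - (a • y + b • y') = a • (x - y) + b • (x' - y') := by module
    rw [this]
    exact add_mem (Submodule.smul_mem _ _ hxy) (Submodule.smul_mem _ _ hxy')
  convert mem_steiner (hK hx hx' ha hb hab) (hK hy hy' ha hb hab) h using 1
  simp only [map_add, map_smul]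
  module

omit [FiniteDimensional ℝ E] [MeasurableSpace E] [BorelSpace E] in
theorem neg_mem_steiner (hsym : ∀ x ∈ K, -x ∈ K) : ∀ x ∈ steiner u K, -x ∈ steiner u K := by
  rintro _ ⟨⟨x, y⟩, ⟨⟨hx, hy⟩, hxy⟩, rfl⟩
  have h : -x - -y ∈ ℝ ∙ u := by
    have : -x - -y = -(x - y) := by abel
    rw [this]
    exact neg_mem hxy
  convert mem_steiner (hsym _ hx) (hsym _ hy) h using 1
  simp only [map_neg]
  module

omit [FiniteDimensional ℝ E] [MeasurableSpace E] [BorelSpace E] in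
theorem steiner_subset_closedBall {R : ℝ} (hR : K ⊆ closedBall 0 R) :
    steiner u K ⊆ closedBall 0 R := by
  rintro _ ⟨⟨x, y⟩, ⟨⟨hx, hy⟩, -⟩, rfl⟩
  have h1 := mem_closedBall_zero_iff.1 (hR hx)
  have h2 := mem_closedBall_zero_iff.1 (hR hy)
  have h3 : ‖x + hypRefl u y‖ ≤ ‖x‖ + ‖y‖ := by
    simpa using norm_add_le x (hypRefl u y)
  rw [mem_closedBall_zero_iff, norm_smul]
  norm_num
  linarith

omit [FiniteDimensional ℝ E] [MeasurableSpace E] [BorelSpace E] in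
theorem mem_steiner_of_eq_smul {x y : E} (hx : x ∈ K) (hy : y ∈ K)
    (h : ∃ c : ℝ, x - y = c • u) : (1 / 2 : ℝ) • (x + hypRefl u y) ∈ steiner u K :=
  mem_steiner hx hy (Submodule.mem_span_singleton.2 (h.imp fun _ hc => hc.symm))

theorem volume_le_volume_steiner (hu : ‖u‖ = 1) (hK : Convex ℝ K) (hc : IsCompact K) :
    volume K ≤ volume (steiner u K) :=
  volume_le_of_steiner_mem hu hc (convex_steiner hK) (isCompact_steiner hc).measurableSet
    fun _ hx _ hy h => mem_steiner_of_eq_smul hx hy h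

theorem volume_image_isometry (T : E ≃ₗᵢ[ℝ] E) (S : Set E) : volume (T '' S) = volume S := by
  rw [T.image_eq_preimage_symm]
  exact T.symm.measurePreserving.measure_preimage_equiv (f := T.symm.toMeasurableEquiv) S

theorem projNorm_steiner_le (hu : ‖u‖ = 1) (hK : Convex ℝ K) (hc : IsCompact K) {x y : E}
    (hxy : ∃ c : ℝ, x - y = c • u) :
    projNorm (steiner u K) ((1 / 2 : ℝ) • (x + hypRefl u y)) ≤
      (projNorm K x + projNorm K y) / 2 := by
  have hseg := fun z => hc.add (isCompact_segment (0 : E) z)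
  have hcv := fun z => hK.add (convex_segment (0 : E) z)
  have key := volume_le_of_mem_line_average hu (A := K + segment ℝ 0 x)
    (B := hypRefl u '' (K + segment ℝ 0 y))
    (C := steiner u K + segment ℝ 0 ((1 / 2 : ℝ) • (x + hypRefl u y)))
    (by norm_num : (0 : ℝ) ≤ 1 / 2) (by norm_num : (0 : ℝ) ≤ 1 / 2) (by norm_num)
    (hcv x) (hseg x) ((hcv y).linear_image (hypRefl u).toLinearEquiv.toLinearMap)
    ((hseg y).image (hypRefl u).continuous)
    ((isCompact_steiner hc).add (isCompact_segment _ _)).measurableSet ?_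
  · rw [volume_image_isometry] at key
    have hfin := fun z => (hseg z).measure_ne_top (μ := (volume : Measure E))
    have h1 := ENNReal.toReal_mono (by finiteness [hfin x, hfin y]) key
    rw [ENNReal.toReal_add (by finiteness [hfin x]) (by finiteness [hfin y]), ENNReal.toReal_mul,
      ENNReal.toReal_mul, ENNReal.toReal_ofReal (by norm_num)] at h1
    have h2 := ENNReal.toReal_mono (isCompact_steiner hc).measure_ne_top
      (volume_le_volume_steiner hu hK hc)
    simp only [projNorm, Measure.real]
    linarith
  · intro z hz
    obtain ⟨_, ⟨⟨p, q⟩, ⟨⟨hp, hq⟩, hpq⟩, rfl⟩, t, ht, rfl⟩ := mem_add_segment.1 hz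
    refine ⟨p + t • x, mem_add_segment.2 ⟨p, hp, t, ht, rfl⟩, hypRefl u (q + t • y),
      mem_image_of_mem _ (mem_add_segment.2 ⟨q, hq, t, ht, rfl⟩), ?_, ?_⟩
    · obtain ⟨c, hxy⟩ := hxy
      obtain ⟨c', hpq⟩ := Submodule.mem_span_singleton.1 hpq
      obtain ⟨w, s, hws⟩ := exists_eq_add_smul u (q + t • y)
      have hpx : p + t • x = (q + t • y) + (c' + t * c) • u := by
        rw [add_smul, mul_smul, ← hxy, hpq]
        module
      refine ⟨c' + t * c + 2 * s, ?_⟩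
      rw [hpx, hws, hypRefl_add_smul]
      module
    · simp only [map_add, map_smul]
      module

theorem volume_polarProj_le_steiner (hu : ‖u‖ = 1) (hK : Convex ℝ K) (hc : IsCompact K)
    (hi : (interior K).Nonempty) :
    volume (polarProj K) ≤ volume (polarProj (steiner u K)) := by
  refine volume_le_of_steiner_mem hu (isCompact_polarProj hK hc hi)
    (convex_polarProj (convex_steiner hK) (isCompact_steiner hc))
    (isClosed_polarProj (convex_steiner hK) (isCompact_steiner hc)).measurableSet
    fun x hx y hy h => ?_
  have h1 : projNorm K x ≤ 1 := hx
  have h2 : projNorm K y ≤ 1 := hy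
  have := projNorm_steiner_le hu hK hc h
  change projNorm _ _ ≤ 1
  linarith

/-- The weighted length of a symmetrized interval is at least that of the interval. -/
theorem lintegral_le_of_half_diff_mem {F G : Set ℝ} (hF : IsCompact F) (hF' : F.OrdConnected)
    (hG : G.OrdConnected) (h : ∀ s ∈ F, ∀ t ∈ F, (s - t) / 2 ∈ G) {A : ℝ}
    (hA : ∀ s ∈ F, s ^ 2 ≤ A) :
    ∫⁻ s in F, ENNReal.ofReal (A - s ^ 2) ≤ ∫⁻ s in G, ENNReal.ofReal (A - s ^ 2) ∧
    (∫⁻ s in F, ENNReal.ofReal (A - s ^ 2) = ∫⁻ s in G, ENNReal.ofReal (A - s ^ 2) →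
      volume (F \ -F) = 0) := by
  rcases F.eq_empty_or_nonempty with rfl | hne
  · simp
  obtain ⟨a, b, hab, rfl⟩ := eq_Icc_of_isCompact_ordConnected hF hF' hne
  have hint : ∀ c d : ℝ, c ≤ d → c ^ 2 ≤ A → d ^ 2 ≤ A →
      ∫⁻ s in Icc c d, ENNReal.ofReal (A - s ^ 2) =
        ENNReal.ofReal (A * (d - c) - (d ^ 3 - c ^ 3) / 3) := by
    intro c d hcd hc hd
    rw [← ofReal_integral_eq_lintegral_ofReal]
    · congr 1
      rw [integral_Icc_eq_integral_Ioc, ← intervalIntegral.integral_of_le hcd,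
        intervalIntegral.integral_sub (by simp) (by simp)]
      simp
      ring
    · exact (Continuous.continuousOn (by fun_prop)).integrableOn_Icc
    · filter_upwards [ae_restrict_mem measurableSet_Icc] with s hs
      have h1 := hs.1
      have h2 := hs.2
      simp only [Pi.zero_apply, sub_nonneg]
      rcases le_total 0 s with h0 | h0 <;> nlinarith
  have ha : a ^ 2 ≤ A := hA a ⟨le_rfl, hab⟩
  have hb : b ^ 2 ≤ A := hA b ⟨hab, le_rfl⟩
  have hl : ((b - a) / 2) ^ 2 ≤ A := by nlinarith [sq_nonneg (a + b)]
  have hl' : ((a - b) / 2) ^ 2 ≤ A := by nlinarith [sq_nonneg (a + b)]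
  have hGsub : Icc ((a - b) / 2) ((b - a) / 2) ⊆ G :=
    hG.out (h _ ⟨le_rfl, hab⟩ _ ⟨hab, le_rfl⟩) (h _ ⟨hab, le_rfl⟩ _ ⟨le_rfl, hab⟩)
  have hGle : ENNReal.ofReal (A * (b - a) - (b - a) ^ 3 / 12) ≤
      ∫⁻ s in G, ENNReal.ofReal (A - s ^ 2) := by
    refine le_trans (le_of_eq ?_) (lintegral_mono_set hGsub)
    rw [hint _ _ (by linarith) hl' hl]
    congr 1
    ring
  rw [hint a b hab ha hb] at *
  have hid : A * (b - a) - (b - a) ^ 3 / 12 =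
      (A * (b - a) - (b ^ 3 - a ^ 3) / 3) + (b - a) * (a + b) ^ 2 / 4 := by ring
  have hnn : 0 ≤ (b - a) * (a + b) ^ 2 / 4 := by
    have := sub_nonneg.2 hab
    positivity
  have hpos : 0 ≤ A * (b - a) - (b - a) ^ 3 / 12 := by
    have : A * (b - a) - (b - a) ^ 3 / 12 = (b - a) * (A - ((b - a) / 2) ^ 2 / 3) := by ring
    rw [this]
    refine mul_nonneg (sub_nonneg.2 hab) ?_
    nlinarith [sq_nonneg ((b - a) / 2)]
  refine ⟨le_trans (ENNReal.ofReal_le_ofReal (by linarith)) hGle, fun heq => ?_⟩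
  have h1 : ENNReal.ofReal (A * (b - a) - (b - a) ^ 3 / 12) ≤
      ENNReal.ofReal (A * (b - a) - (b ^ 3 - a ^ 3) / 3) := by rw [heq]; exact hGle
  rcases hab.eq_or_lt with rfl | hlt
  · exact measure_mono_null sdiff_subset (by simp)
  have hposF : 0 ≤ A * (b - a) - (b ^ 3 - a ^ 3) / 3 := by
    have : A * (b - a) - (b ^ 3 - a ^ 3) / 3 = (b - a) * (A - (b ^ 2 + a * b + a ^ 2) / 3) := by
      ring
    rw [this]
    refine mul_nonneg (sub_nonneg.2 hab) ?_
    nlinarith [sq_nonneg (a - b)]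
  rw [ENNReal.ofReal_le_ofReal_iff hposF] at h1
  have h2 : (b - a) * (a + b) ^ 2 = 0 := by nlinarith
  have h3 : a = -b := by
    rcases mul_eq_zero.1 h2 with h4 | h4
    · linarith
    · have := pow_eq_zero_iff (two_ne_zero) |>.1 h4
      linarith
  subst h3
  simp

end Steiner

section Petty

open scoped Pointwise
open TopologicalSpace

variable {E : Type*} [NormedAddCommGroup E] [InnerProductSpace ℝ E] [FiniteDimensional ℝ E]
  [MeasurableSpace E] [BorelSpace E] {u : E} {K : Set E}

/-- The measure with density `R² - ‖x‖²` on the ball of radius `R`. -/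
def paraboloidMeasure (E : Type*) [NormedAddCommGroup E] [InnerProductSpace ℝ E]
    [FiniteDimensional ℝ E] [MeasurableSpace E] [BorelSpace E] (R : ℝ) : Measure E :=
  (volume : Measure E).withDensity fun x => ENNReal.ofReal (R ^ 2 - ‖x‖ ^ 2)

instance (R : ℝ) : IsLocallyFiniteMeasure (paraboloidMeasure E R) :=
  IsLocallyFiniteMeasure.withDensity_ofReal (by fun_prop)

omit [FiniteDimensional ℝ E] [MeasurableSpace E] [BorelSpace E] in
theorem norm_sq_add_smul (hu : ‖u‖ = 1) (w : (ℝ ∙ u)ᗮ) (s : ℝ) :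
    ‖(w : E) + s • u‖ ^ 2 = ‖(w : E)‖ ^ 2 + s ^ 2 := by
  rw [norm_add_sq_real, inner_smul_right, inner_orthogonal_singleton, norm_smul, hu]
  simp

omit [FiniteDimensional ℝ E] in
theorem measurableSet_lineFiber {S : Set E} (hS : MeasurableSet S) (w : (ℝ ∙ u)ᗮ) :
    MeasurableSet (lineFiber u S w) :=
  (by fun_prop : Measurable fun s : ℝ => (w : E) + s • u) hS

theorem paraboloidMeasure_eq_lintegral (hu : ‖u‖ = 1) (R : ℝ) {S : Set E} (hS : MeasurableSet S) :
    Measurable (fun w : (ℝ ∙ u)ᗮ =>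
      ∫⁻ s in lineFiber u S w, ENNReal.ofReal ((R ^ 2 - ‖(w : E)‖ ^ 2) - s ^ 2)) ∧
    paraboloidMeasure E R S = ∫⁻ w : (ℝ ∙ u)ᗮ,
      ∫⁻ s in lineFiber u S w, ENNReal.ofReal ((R ^ 2 - ‖(w : E)‖ ^ 2) - s ^ 2) := by
  have hmeas : Measurable (S.indicator fun x : E => ENNReal.ofReal (R ^ 2 - ‖x‖ ^ 2)) :=
    Measurable.indicator (by fun_prop) hS
  have hfib : ∀ w : (ℝ ∙ u)ᗮ,
      ∫⁻ s in lineFiber u S w, ENNReal.ofReal ((R ^ 2 - ‖(w : E)‖ ^ 2) - s ^ 2) =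
        ∫⁻ s : ℝ, S.indicator (fun x : E => ENNReal.ofReal (R ^ 2 - ‖x‖ ^ 2)) ((w : E) + s • u) := by
    intro w
    rw [← lintegral_indicator (measurableSet_lineFiber hS w)]
    refine lintegral_congr fun s => ?_
    by_cases hs : (w : E) + s • u ∈ S
    · rw [indicator_of_mem hs, indicator_of_mem (mem_lineFiber.2 hs), norm_sq_add_smul hu]
      ring_nf
    · rw [indicator_of_notMem hs, indicator_of_notMem (mt mem_lineFiber.1 hs)]
  simp only [hfib]
  constructor
  · exact (hmeas.comp (measurePreserving_add_smul hu).measurable).lintegral_prod_right'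
  · rw [paraboloidMeasure, withDensity_apply _ hS, ← lintegral_indicator hS,
      lintegral_eq_lintegral_line hu hmeas]

theorem paraboloidMeasure_steiner (hu : ‖u‖ = 1) (hK : Convex ℝ K) (hc : IsCompact K) {R : ℝ}
    (hR : K ⊆ closedBall 0 R)
    (hle : paraboloidMeasure E R (steiner u K) ≤ paraboloidMeasure E R K) :
    volume (K \ hypRefl u '' K) = 0 := by
  have hfin : paraboloidMeasure E R K ≠ ∞ := hc.measure_ne_top
  obtain ⟨-, h1⟩ := paraboloidMeasure_eq_lintegral hu R hc.measurableSet
  obtain ⟨hm, h2⟩ := paraboloidMeasure_eq_lintegral hu R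
    (isCompact_steiner (u := u) hc).measurableSet
  have hfib := fun w : (ℝ ∙ u)ᗮ => lintegral_le_of_half_diff_mem (A := R ^ 2 - ‖(w : E)‖ ^ 2)
    (isCompact_lineFiber hu hc w) (ordConnected_lineFiber hK w)
    (ordConnected_lineFiber (convex_steiner hK) w)
    (G := lineFiber u (steiner u K) w)
    (fun s hs t ht => by
      rw [mem_lineFiber, ← half_smul_add_hypRefl]
      exact mem_steiner_of_eq_smul hs ht ⟨s - t, by module⟩)
    (fun s hs => by
      have h3 := mem_closedBall_zero_iff.1 (hR hs)
      have h4 := norm_sq_add_smul hu w s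
      have h5 := pow_le_pow_left₀ (norm_nonneg _) h3 2
      linarith)
  rw [h1] at hle hfin
  rw [h2] at hle
  have hae := ae_eq_of_ae_le_of_lintegral_le (ae_of_all _ fun w => (hfib w).1) hfin
    hm.aemeasurable hle
  have hmeas : MeasurableSet (K \ hypRefl u '' K) :=
    hc.measurableSet.diff (hc.image (hypRefl u).continuous).measurableSet
  rw [volume_eq_lintegral_lineFiber hu hmeas, lintegral_eq_zero_iff
    (measurable_volume_lineFiber hu hmeas)]
  filter_upwards [hae] with w hw
  have h3 := (hfib w).2 hw
  have h4 : lineFiber u (K \ hypRefl u '' K) w = lineFiber u K w \ -lineFiber u K w := by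
    ext s
    have : (w : E) + s • u ∈ hypRefl u '' K ↔ (w : E) + (-s) • u ∈ K := by
      constructor
      · rintro ⟨x, hx, h⟩
        have h5 : x = hypRefl u (w + s • u) := by rw [← h]; simp
        rw [hypRefl_add_smul] at h5
        rw [neg_smul, ← sub_eq_add_neg, ← h5]
        exact hx
      · intro h
        refine ⟨_, h, ?_⟩
        rw [hypRefl_add_smul]
        module
    simp only [mem_lineFiber, Set.mem_sdiff, Set.mem_neg, this]
  rw [h4, h3]
  rfl

theorem subset_of_volume_diff_eq_zero {M N : Set E} (hM : Convex ℝ M) (hi : (interior M).Nonempty)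
    (hN : IsClosed N) (h : volume (M \ N) = 0) : M ⊆ N := by
  have h1 : interior M \ N = ∅ := by
    refine (isOpen_interior.sdiff hN).eq_empty_of_measure_zero (μ := volume) ?_
    exact measure_mono_null (sdiff_subset_sdiff_left interior_subset) h
  have h2 : interior M ⊆ N := sdiff_eq_empty.1 h1
  calc M ⊆ closure M := subset_closure
    _ = closure (interior M) := (hM.closure_interior_eq_closure_of_nonempty_interior hi).symm
    _ ⊆ N := hN.closure_subset_iff.2 h2

omit [FiniteDimensional ℝ E] [MeasurableSpace E] [BorelSpace E] in
theorem eq_closedBall_of_subset_image_hypRefl {M : Set E} (hM : Convex ℝ M) (hc : IsCompact M)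
    (hne : M.Nonempty) (hsym : ∀ x ∈ M, -x ∈ M)
    (h : ∀ u : E, ‖u‖ = 1 → M ⊆ hypRefl u '' M) : ∃ ρ, 0 ≤ ρ ∧ M = closedBall 0 ρ := by
  obtain ⟨m, hm, hmax⟩ := hc.exists_isMaxOn hne continuous_norm.continuousOn
  refine ⟨‖m‖, norm_nonneg _, subset_antisymm
    (fun x hx => mem_closedBall_zero_iff.2 (hmax hx)) fun x hx => ?_⟩
  rw [mem_closedBall_zero_iff] at hx
  have hsph : ∀ v : E, ‖v‖ = ‖m‖ → v ∈ M := by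
    intro v hv
    rcases eq_or_ne (v - m) 0 with h0 | h0
    · rw [sub_eq_zero.1 h0]
      exact hm
    obtain ⟨u, hu, huv⟩ := exists_eq_smul_unit h0
    have hspan : (ℝ ∙ (v - m)) = ℝ ∙ u := by
      rw [huv]
      exact Submodule.span_singleton_smul_eq (IsUnit.mk0 _ (norm_ne_zero_iff.2 h0)) u
    have h1 : hypRefl u v = m := by
      have h2 : (ℝ ∙ (v - m))ᗮ.reflection v = m := Submodule.reflection_sub hv
      have h3 : (hypRefl (v - m)) v = hypRefl u v := by
        obtain ⟨w, s, hws⟩ := exists_eq_add_smul (v - m) v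
        have hw : (w : E) ∈ (ℝ ∙ u)ᗮ := hspan ▸ w.2
        have h4 := hypRefl_add_smul u ⟨w, hw⟩ (s * ‖v - m‖)
        rw [mul_smul, ← huv] at h4
        have h5 := hypRefl_add_smul (v - m) w s
        rw [hws.symm] at h5
        have h6 : (⟨w, hw⟩ : (ℝ ∙ u)ᗮ) + s • (v - m) = v := hws.symm
        rw [h6] at h4
        rw [h4, h5]
      rw [← h3]
      exact h2
    obtain ⟨z, hz, hzm⟩ := h u hu hm
    have : z = v := by
      have : hypRefl u z = hypRefl u v := by rw [hzm, h1]
      exact (hypRefl u).injective this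
    exact this ▸ hz
  rcases eq_or_ne x 0 with rfl | hx0
  · have := hM hm (hsym m hm) (by norm_num : (0 : ℝ) ≤ 1 / 2) (by norm_num : (0 : ℝ) ≤ 1 / 2)
      (by norm_num)
    simpa using this
  · obtain ⟨u, hu, hxu⟩ := exists_eq_smul_unit hx0
    have h1 : ‖m‖ • u ∈ M := hsph _ (by rw [norm_smul, hu]; simp)
    rcases (norm_nonneg m).eq_or_lt with hm0 | hm0
    · exact absurd (norm_le_zero_iff.1 (hm0 ▸ hx)) hx0
    have hratio : ‖x‖ / ‖m‖ ≤ 1 := (div_le_one hm0).2 hx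
    have := hM h1 (hsym _ h1) (by positivity : 0 ≤ (1 + ‖x‖ / ‖m‖) / 2)
      (by linarith : 0 ≤ (1 - ‖x‖ / ‖m‖) / 2) (by ring)
    convert this using 1
    have h2 : ∀ c r : ℝ, (c * r) • u = ((1 + c) / 2) • r • u + ((1 - c) / 2) • -(r • u) :=
      fun c r => by module
    rw [← h2, div_mul_cancel₀ _ hm0.ne']
    exact hxu

/-- A ball dominates every convex body simultaneously in volume and in volume of the polar
projection body. -/
theorem exists_closedBall_volume_le (hd : 1 ≤ Module.finrank ℝ E) (hK : Convex ℝ K)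
    (hc : IsCompact K) (hi : (interior K).Nonempty) (hsym : ∀ x ∈ K, -x ∈ K) :
    ∃ ρ > 0, volume K ≤ volume (closedBall (0 : E) ρ) ∧
      volume (polarProj K) ≤ volume (polarProj (closedBall (0 : E) ρ)) := by
  have : Nontrivial E := Module.finrank_pos_iff (R := ℝ).1 (by omega)
  obtain ⟨R, hR⟩ := hc.isBounded.subset_closedBall (0 : E)
  have hKpos : volume K ≠ 0 := (Measure.measure_pos_of_nonempty_interior _ hi).ne'
  let K' : NonemptyCompacts E := ⟨⟨K, hc⟩, hi.mono interior_subset⟩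
  have hK' : K' ∈ symmetricBodies E R (volume K) (volume (polarProj K)) :=
    ⟨hR, hK, hsym, le_rfl, le_rfl⟩
  obtain ⟨M, ⟨hMR, hMconv, hMsym, hMvol, hMpol⟩, hmax⟩ :=
    UpperSemicontinuousOn.exists_isMaxOn ⟨K', hK'⟩
    (isCompact_symmetricBodies hd R hKpos (volume (polarProj K)))
    ((upperSemicontinuous_measure_nonemptyCompacts (paraboloidMeasure E R)).upperSemicontinuousOn _)
  have hMi : (interior (M : Set E)).Nonempty :=
    interior_nonempty_of_volume_ne_zero hMconv (ne_bot_of_le_ne_bot hKpos hMvol)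
  obtain ⟨ρ, hρ, hball⟩ := eq_closedBall_of_subset_image_hypRefl hMconv M.isCompact M.nonempty hMsym
    (by
      intro u hu
      refine subset_of_volume_diff_eq_zero hMconv hMi
        (M.isCompact.image (hypRefl u).continuous).isClosed ?_
      refine paraboloidMeasure_steiner hu hMconv M.isCompact hMR ?_
      have hne : (steiner u (M : Set E)).Nonempty := by
        obtain ⟨x, hx⟩ := M.nonempty
        exact ⟨_, mem_steiner_of_eq_smul hx hx ⟨0, by simp⟩⟩
      let S : NonemptyCompacts E := ⟨⟨_, isCompact_steiner M.isCompact⟩, hne⟩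
      have hS : S ∈ symmetricBodies E R (volume K) (volume (polarProj K)) :=
        ⟨steiner_subset_closedBall hMR, convex_steiner hMconv, neg_mem_steiner hMsym,
          hMvol.trans (volume_le_volume_steiner hu hMconv M.isCompact),
          hMpol.trans (volume_polarProj_le_steiner hu hMconv M.isCompact hMi)⟩
      exact hmax hS)
  refine ⟨ρ, hρ.lt_of_ne ?_, hball ▸ hMvol, hball ▸ hMpol⟩
  rintro rfl
  rw [hball] at hMvol
  simp [hKpos] at hMvol

/-- **Petty projection inequality** for symmetric convex bodies. -/
theorem petty_projection_inequality (hd : 1 ≤ Module.finrank ℝ E) (hK : Convex ℝ K)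
    (hc : IsCompact K) (hi : (interior K).Nonempty) (hsym : ∀ x ∈ K, -x ∈ K) :
    volume.real K ^ (Module.finrank ℝ E - 1) * volume.real (polarProj K) ≤
      volume.real (closedBall (0 : E) 1) ^ (Module.finrank ℝ E - 1) *
        volume.real (polarProj (closedBall (0 : E) 1)) := by
  have : Nontrivial E := Module.finrank_pos_iff (R := ℝ).1 (by omega)
  obtain ⟨ρ, hρ, h1, h2⟩ := exists_closedBall_volume_le hd hK hc hi hsym
  have hball : closedBall (0 : E) ρ = ρ • closedBall (0 : E) 1 := by
    rw [smul_unitClosedBall_of_nonneg hρ.le]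
  have hBc : Convex ℝ (closedBall (0 : E) 1) := convex_closedBall _ _
  have hBk : IsCompact (closedBall (0 : E) 1) := isCompact_closedBall _ _
  have hBi : (interior (closedBall (0 : E) 1)).Nonempty :=
    ⟨0, ball_subset_interior_closedBall (mem_ball_self one_pos)⟩
  rw [hball, volume_polarProj_smul hBc hBk hρ hd] at h2
  rw [hball, Measure.addHaar_smul, abs_of_pos (by positivity)] at h1
  have h1' := ENNReal.toReal_mono (ENNReal.mul_ne_top ENNReal.ofReal_ne_top hBk.measure_ne_top) h1
  have h2' := ENNReal.toReal_mono (ENNReal.mul_ne_top ENNReal.ofReal_ne_top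
    (isCompact_polarProj hBc hBk hBi).measure_ne_top) h2
  rw [ENNReal.toReal_mul, ENNReal.toReal_ofReal (by positivity)] at h1' h2'
  change volume.real K ≤ _ * volume.real (closedBall (0 : E) 1) at h1'
  change volume.real (polarProj K) ≤ _ * volume.real (polarProj (closedBall (0 : E) 1)) at h2'
  refine (mul_le_mul (pow_le_pow_left₀ measureReal_nonneg h1' _) h2' measureReal_nonneg
    (by positivity)).trans_eq ?_
  rw [mul_pow, mul_mul_mul_comm, ← pow_mul, inv_pow, ← pow_mul, mul_comm (Module.finrank ℝ E),
    mul_inv_cancel₀ (by positivity), one_mul]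

end Petty

section PolarCoordinates

variable {E : Type*} [NormedAddCommGroup E] [InnerProductSpace ℝ E] [FiniteDimensional ℝ E]
  [MeasurableSpace E] [BorelSpace E]

theorem volumeIoiPow_apply_Iic (n : ℕ) (x : Ioi (0 : ℝ)) :
    Measure.volumeIoiPow n (Iic x) = ENNReal.ofReal (x.1 ^ (n + 1) / (n + 1)) := by
  have : NullSingletonClass (Measure.volumeIoiPow n) := by
    refine ⟨fun y => withDensity_absolutelyContinuous _ _ ?_⟩
    rw [comap_subtype_coe_apply measurableSet_Ioi, image_singleton, Real.volume_singleton]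
  rw [← Measure.volumeIoiPow_apply_Iio, measure_congr Iio_ae_eq_Iic]

/-- The volume of a star-shaped set in polar coordinates. -/
theorem volume_sublevel_homogeneous [Nontrivial E] {H : E → ℝ} (hH : Measurable H)
    (hpos : ∀ x, ‖x‖ = 1 → 0 < H x) (hsmul : ∀ (r : ℝ) (x : E), 0 < r → H (r • x) = r * H x) :
    volume {x | H x ≤ 1} = ∫⁻ θ : sphere (0 : E) 1,
      ENNReal.ofReal ((H θ)⁻¹ ^ Module.finrank ℝ E / Module.finrank ℝ E)
        ∂(volume : Measure E).toSphere := by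
  have hd : 0 < Module.finrank ℝ E := Module.finrank_pos
  have hA : MeasurableSet {x : E | H x ≤ 1} := measurableSet_le hH measurable_const
  have h0 : volume {x : E | H x ≤ 1} = (volume.comap ((↑) : ({0}ᶜ : Set E) → E))
      (((↑) : ({0}ᶜ : Set E) → E) ⁻¹' {x | H x ≤ 1}) := by
    rw [comap_subtype_coe_apply (measurableSet_singleton _).compl, Subtype.image_preimage_coe,
      inter_comm, ← sdiff_eq, measure_sdiff_null (measure_singleton _)]
  set S : Set (sphere (0 : E) 1 × Ioi (0 : ℝ)) := {p | p.2.1 * H p.1 ≤ 1} with hS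
  have hSm : MeasurableSet S := by
    refine measurableSet_le ?_ measurable_const
    exact (measurable_subtype_coe.comp measurable_snd).mul
      (hH.comp (measurable_subtype_coe.comp measurable_fst))
  have h1 : ((↑) : ({0}ᶜ : Set E) → E) ⁻¹' {x | H x ≤ 1} =
      homeomorphUnitSphereProd E ⁻¹' S := by
    ext ⟨x, hx⟩
    have hx' : 0 < ‖x‖ := norm_pos_iff.2 hx
    simp only [mem_preimage, mem_ofPred_eq, hS, homeomorphUnitSphereProd_apply_snd_coe,
      homeomorphUnitSphereProd_apply_fst_coe]
    rw [← hsmul _ _ hx', smul_inv_smul₀ hx'.ne']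
  rw [h0, h1, ((volume : Measure E).measurePreserving_homeomorphUnitSphereProd).measure_preimage
    hSm.nullMeasurableSet, Measure.prod_apply hSm]
  refine lintegral_congr fun θ => ?_
  have hθ : 0 < H θ := hpos θ (by simp)
  have : Prod.mk θ ⁻¹' S = Iic (⟨(H θ)⁻¹, inv_pos.2 hθ⟩ : Ioi (0 : ℝ)) := by
    ext ⟨r, hr⟩
    change r * H θ ≤ 1 ↔ r ≤ (H θ)⁻¹
    rw [← one_div, le_div_iff₀ hθ]
  rw [this, volumeIoiPow_apply_Iic, Nat.sub_add_cancel hd, Nat.cast_pred hd, sub_add_cancel]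

theorem volumeReal_sublevel_homogeneous [Nontrivial E] {H : E → ℝ} (hH : Measurable H)
    (hpos : ∀ x, ‖x‖ = 1 → 0 < H x) (hsmul : ∀ (r : ℝ) (x : E), 0 < r → H (r • x) = r * H x) :
    volume.real {x | H x ≤ 1} = (∫ θ : sphere (0 : E) 1,
      (H θ)⁻¹ ^ Module.finrank ℝ E ∂(volume : Measure E).toSphere) / Module.finrank ℝ E := by
  rw [measureReal_def, volume_sublevel_homogeneous hH hpos hsmul, ← integral_div,
    integral_eq_lintegral_of_nonneg_ae]
  · filter_upwards with θ
    have := hpos θ (by simp)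
    positivity
  · exact (((hH.comp measurable_subtype_coe).inv.pow_const _).div_const _).aestronglyMeasurable

end PolarCoordinates

section MeanWidth

open scoped Pointwise

theorem hasDerivAt_le_of_le {f g : ℝ → ℝ} {a b : ℝ} (hf : HasDerivAt f a 0)
    (hg : HasDerivAt g b 0) (h0 : f 0 = g 0) (hle : ∀ t, 0 < t → f t ≤ g t) : a ≤ b := by
  have h := (hasDerivAt_iff_tendsto_slope.1 (hg.sub hf)).mono_left
    (nhdsWithin_mono 0 fun x (hx : x ∈ Ioi (0 : ℝ)) => (mem_Ioi.1 hx).ne')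
  refine sub_nonneg.1 (ge_of_tendsto h ?_)
  filter_upwards [self_mem_nhdsWithin] with t ht
  have ht : 0 < t := ht
  have := hle t ht
  simp only [slope_def_field, Pi.sub_apply, h0, sub_self, sub_zero]
  exact div_nonneg (by linarith) ht.le

variable {E : Type*} [NormedAddCommGroup E] [InnerProductSpace ℝ E] [FiniteDimensional ℝ E]
  [MeasurableSpace E] [BorelSpace E] {u : E}

theorem integrable_sphere_of_continuous {f : sphere (0 : E) 1 → ℝ} (hf : Continuous f) :
    Integrable f (volume : Measure E).toSphere := by
  have : CompactSpace (sphere (0 : E) 1) := isCompact_iff_compactSpace.1 (isCompact_sphere 0 1)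
  exact hf.integrable_of_hasCompactSupport (HasCompactSupport.of_compactSpace f)

omit [FiniteDimensional ℝ E] [MeasurableSpace E] [BorelSpace E] in
theorem mem_smul_closedBall_add_segment (hu : ‖u‖ = 1) {t : ℝ} (ht : 0 < t) {x : E}
    (hx : ‖x‖ ^ 2 / (‖x‖ + t * max ⟪x, u⟫ 0) ≤ 1) :
    x ∈ (1 + t ^ 2) • (closedBall (0 : E) 1 + segment ℝ 0 (t • u)) := by
  have hT : (1 : ℝ) ≤ 1 + t ^ 2 := by nlinarith
  have hT0 : (0 : ℝ) < 1 + t ^ 2 := by linarith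
  set l := ‖x‖ ^ 2 / (‖x‖ + t * max ⟪x, u⟫ 0) with hl
  have key : ∃ s : ℝ, 0 ≤ s ∧ s ≤ 1 ∧ ‖x - (s * t) • u‖ ≤ 1 + t ^ 2 := by
    rcases le_or_gt ⟪x, u⟫ 0 with hi | hi
    · refine ⟨0, le_rfl, zero_le_one, ?_⟩
      rw [max_eq_right hi, mul_zero, add_zero] at hl
      rcases (norm_nonneg x).eq_or_lt with h0 | h0
      · simp [← h0]; linarith
      · rw [sq, mul_div_assoc, div_self h0.ne', mul_one] at hl
        simp; linarith
    · rw [max_eq_left hi.le] at hl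
      have h0 : 0 < ‖x‖ := norm_pos_iff.2 (by rintro rfl; simp at hi)
      have hden : 0 < ‖x‖ + t * ⟪x, u⟫ := by positivity
      have hl0 : 0 ≤ l := by rw [hl]; positivity
      refine ⟨l, hl0, hx, ?_⟩
      have hr : ‖x‖ ^ 2 = l * (‖x‖ + t * ⟪x, u⟫) := by rw [hl]; field_simp
      refine (sq_le_sq₀ (norm_nonneg _) hT0.le).1 ?_
      rw [norm_sub_sq_real, inner_smul_right, norm_smul, hu, mul_one, Real.norm_eq_abs, sq_abs]
      set c := ⟪x, u⟫ / ‖x‖ with hc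
      have hpc : ⟪x, u⟫ = c * ‖x‖ := by rw [hc]; field_simp
      have hrc : ‖x‖ = l * (1 + t * c) := by
        refine mul_right_cancel₀ h0.ne' ?_
        rw [← sq, hr, hpc]; ring
      have hl2 : l ^ 2 ≤ 1 := pow_le_one₀ hl0 hx
      calc ‖x‖ ^ 2 - 2 * (l * t * ⟪x, u⟫) + (l * t) ^ 2
          = l ^ 2 * (1 + t ^ 2 - t ^ 2 * c ^ 2) := by rw [hpc, hrc]; ring
        _ ≤ l ^ 2 * (1 + t ^ 2) := by gcongr; nlinarith [sq_nonneg (t * c)]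
        _ ≤ 1 * (1 + t ^ 2) := by gcongr
        _ ≤ (1 + t ^ 2) ^ 2 := by nlinarith
  obtain ⟨s, hs0, hs1, hs⟩ := key
  rw [mem_smul_set_iff_inv_smul_mem₀ hT0.ne', mem_add]
  refine ⟨(1 + t ^ 2)⁻¹ • (x - (s * t) • u), ?_, ((1 + t ^ 2)⁻¹ * s) • t • u, ?_, ?_⟩
  · rw [mem_closedBall_zero_iff, norm_smul, Real.norm_of_nonneg (by positivity),
      inv_mul_le_iff₀ hT0, mul_one]
    exact hs
  · rw [segment_eq_image]
    refine ⟨(1 + t ^ 2)⁻¹ * s, ⟨by positivity, ?_⟩, by simp⟩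
    exact mul_le_one₀ (inv_le_one_of_one_le₀ hT) hs0 hs1
  · module

/-- The integral of the positive part of a linear functional over the sphere is at most the
projection norm of the unit ball. -/
theorem integral_max_inner_le [Nontrivial E] (hu : ‖u‖ = 1) :
    ∫ θ : sphere (0 : E) 1, max ⟪(θ : E), u⟫ 0 ∂(volume : Measure E).toSphere ≤
      projNorm (closedBall (0 : E) 1) u := by
  have hd : 0 < Module.finrank ℝ E := Module.finrank_pos
  set d := Module.finrank ℝ E with hd_def
  set κ := volume.real (closedBall (0 : E) 1) with hκ
  set β := projNorm (closedBall (0 : E) 1) u with hβ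
  set M := ∫ θ : sphere (0 : E) 1, max ⟪(θ : E), u⟫ 0 ∂(volume : Measure E).toSphere with hM
  have hσ : (volume : Measure E).toSphere.real univ = d * κ := by
    rw [Measure.toSphere_real_apply_univ, hκ, measureReal_def, measureReal_def,
      Measure.addHaar_closedBall_eq_addHaar_ball]
  have hint : Integrable (fun θ : sphere (0 : E) 1 => max ⟪(θ : E), u⟫ 0)
      (volume : Measure E).toSphere := integrable_sphere_of_continuous (by fun_prop)
  have key : ∀ t : ℝ, 0 < t → κ + t * M ≤ (1 + t ^ 2) ^ d * (κ + t * β) := by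
    intro t ht
    have hT0 : (0 : ℝ) < 1 + t ^ 2 := by positivity
    set H : E → ℝ := fun x => ‖x‖ ^ 2 / (‖x‖ + t * max ⟪x, u⟫ 0) with hH
    have hvol := volumeReal_sublevel_homogeneous (H := H) (by fun_prop)
      (fun x hx => by simp only [hH, hx]; positivity)
      (fun r x hr => by
        simp only [hH, norm_smul, real_inner_smul_left, Real.norm_of_nonneg hr.le]
        rw [show max (r * ⟪x, u⟫) 0 = r * max ⟪x, u⟫ 0 by
          rw [mul_max_of_nonneg _ _ hr.le, mul_zero]]
        rw [show r * ‖x‖ + t * (r * max ⟪x, u⟫ 0) = r * (‖x‖ + t * max ⟪x, u⟫ 0) by ring,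
          mul_pow, sq r, mul_assoc, mul_div_mul_left _ _ hr.ne', mul_div_assoc])
    have hlow : κ + t * M ≤ volume.real {x | H x ≤ 1} := by
      rw [hvol, le_div_iff₀ (by positivity)]
      have : (κ + t * M) * d = ∫ θ : sphere (0 : E) 1, (1 + d * (t * max ⟪(θ : E), u⟫ 0))
          ∂(volume : Measure E).toSphere := by
        rw [integral_add (integrable_const _) ((hint.const_mul _).const_mul _), integral_const,
          integral_const_mul, integral_const_mul, hσ, smul_eq_mul]
        ring
      have hHθ : (fun θ : sphere (0 : E) 1 => (H θ)⁻¹ ^ d) =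
          fun θ : sphere (0 : E) 1 => (1 + t * max ⟪(θ : E), u⟫ 0) ^ d := by
        ext θ
        simp only [hH, norm_eq_of_mem_sphere, one_pow, one_div, inv_inv]
      rw [this, hHθ]
      refine integral_mono ((integrable_const _).add ((hint.const_mul _).const_mul _))
        (integrable_sphere_of_continuous (by fun_prop)) fun θ => ?_
      have hm : 0 ≤ t * max ⟪(θ : E), u⟫ 0 := by positivity
      exact one_add_mul_le_pow (by linarith) d
    have hup : volume.real {x | H x ≤ 1} ≤ (1 + t ^ 2) ^ d * (κ + t * β) := by
      have h1 : volume.real (closedBall (0 : E) 1 + segment ℝ 0 (t • u)) = κ + t * β := by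
        rw [hβ, ← projNorm_smul (convex_closedBall _ _) (isCompact_closedBall _ _) ht.le, projNorm]
        ring
      have hc : IsCompact ((1 + t ^ 2) • (closedBall (0 : E) 1 + segment ℝ 0 (t • u))) :=
        ((isCompact_closedBall _ _).add (isCompact_segment _ _)).smul _
      refine (measureReal_mono (fun x hx => mem_smul_closedBall_add_segment hu ht hx)
        hc.measure_ne_top).trans_eq ?_
      rw [measureReal_def, Measure.addHaar_smul_of_nonneg _ hT0.le, ENNReal.toReal_mul,
        ENNReal.toReal_ofReal (by positivity), ← measureReal_def, h1]
    exact hlow.trans hup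
  have hf : HasDerivAt (fun t : ℝ => κ + t * M) M 0 := by
    simpa using ((hasDerivAt_id (0 : ℝ)).mul_const M).const_add κ
  have hg : HasDerivAt (fun t : ℝ => (1 + t ^ 2) ^ d * (κ + t * β)) β 0 := by
    have h1 : HasDerivAt (fun t : ℝ => (1 + t ^ 2) ^ d) 0 0 := by
      simpa using (((hasDerivAt_id (0 : ℝ)).fun_pow 2).const_add 1).fun_pow d
    have h2 : HasDerivAt (fun t : ℝ => κ + t * β) β 0 := by
      simpa using ((hasDerivAt_id (0 : ℝ)).mul_const β).const_add κ
    simpa using h1.fun_mul h2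
  exact hasDerivAt_le_of_le hf hg (by simp) key

end MeanWidth

section SegmentSums

open scoped Pointwise Topology
open Filter

variable {E : Type*} [NormedAddCommGroup E] [InnerProductSpace ℝ E] [FiniteDimensional ℝ E]
  [MeasurableSpace E] [BorelSpace E] {K : Set E} {ι : Type*}

omit [FiniteDimensional ℝ E] [MeasurableSpace E] [BorelSpace E] in
theorem convex_isCompact_sum_segment (s : Finset ι) (v : ι → E) :
    Convex ℝ (∑ i ∈ s, segment ℝ 0 (v i)) ∧ IsCompact (∑ i ∈ s, segment ℝ 0 (v i)) ∧
      0 ∈ ∑ i ∈ s, segment ℝ 0 (v i) := by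
  classical
  induction s using Finset.induction_on with
  | empty => 
    rw [Finset.sum_empty, ← singleton_zero]
    exact ⟨convex_singleton _, isCompact_singleton, rfl⟩
  | insert i s hi ih =>
    rw [Finset.sum_insert hi]
    refine ⟨(convex_segment _ _).add ih.1, (isCompact_segment _ _).add ih.2.1, ?_⟩
    simpa using add_mem_add (left_mem_segment ℝ 0 (v i)) ih.2.2

theorem volume_add_sum_projNorm_le (hK : Convex ℝ K) (hc : IsCompact K) (s : Finset ι)
    (v : ι → E) :
    volume.real K + ∑ i ∈ s, projNorm K (v i) ≤
      volume.real (K + ∑ i ∈ s, segment ℝ 0 (v i)) := by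
  classical
  induction s using Finset.induction_on with
  | empty => simp
  | insert i s hi ih =>
    obtain ⟨h1, h2, h3⟩ := convex_isCompact_sum_segment s v
    rw [Finset.sum_insert hi, Finset.sum_insert hi, add_comm (segment ℝ 0 (v i)), ← add_assoc K]
    have h := projNorm_mono hK hc (hK.add h1) (hc.add h2)
      (fun x hx => by simpa using add_mem_add hx h3) (v i)
    rw [projNorm.eq_1 (K + _)] at h
    linarith

omit [FiniteDimensional ℝ E] [MeasurableSpace E] [BorelSpace E] in
theorem sum_segment_subset_closedBall (s : Finset ι) (v : ι → E) {R : ℝ} (hR0 : 0 ≤ R)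
    (hR : ∀ u : E, ‖u‖ = 1 → ∑ i ∈ s, max ⟪v i, u⟫ 0 ≤ R) :
    ∑ i ∈ s, segment ℝ 0 (v i) ⊆ closedBall 0 R := by
  intro z hz
  rw [Set.mem_finsetSum] at hz
  obtain ⟨g, hg, rfl⟩ := hz
  set z := ∑ i ∈ s, g i with hz
  rw [mem_closedBall_zero_iff]
  rcases eq_or_ne z 0 with h0 | h0
  · rwa [h0, norm_zero]
  obtain ⟨u, hu, hzu⟩ := exists_eq_smul_unit h0
  have h1 : ‖z‖ = ⟪z, u⟫ := by
    conv_rhs => rw [hzu, real_inner_smul_left, real_inner_self_eq_norm_sq, hu]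
    simp
  rw [h1, hz, sum_inner]
  refine (Finset.sum_le_sum fun i hi => ?_).trans (hR u hu)
  have := hg hi
  rw [segment_eq_image] at this
  obtain ⟨t, ht, h⟩ := this
  rw [← h]
  simp only [smul_zero, zero_add, real_inner_smul_left]
  rcases le_total ⟪v i, u⟫ 0 with hn | hp
  · exact (mul_nonpos_of_nonneg_of_nonpos ht.1 hn).trans (le_max_right _ _)
  · exact (mul_le_of_le_one_left hp ht.2).trans (le_max_left _ _)

theorem sum_projNorm_le (hK : Convex ℝ K) (hc : IsCompact K) (hB : closedBall 0 1 ⊆ K)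
    (s : Finset ι) (v : ι → E) {R : ℝ} (hR0 : 0 ≤ R)
    (hR : ∀ u : E, ‖u‖ = 1 → ∑ i ∈ s, max ⟪v i, u⟫ 0 ≤ R) :
    ∑ i ∈ s, projNorm K (v i) ≤ Module.finrank ℝ E * R * volume.real K := by
  set d := Module.finrank ℝ E with hd
  have key : ∀ t : ℝ, 0 < t → volume.real K + t * ∑ i ∈ s, projNorm K (v i) ≤
      (1 + t * R) ^ d * volume.real K := by
    intro t ht
    have h1 := volume_add_sum_projNorm_le hK hc s fun i => t • v i
    simp only [projNorm_smul hK hc ht.le, ← Finset.mul_sum] at h1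
    have h2 : ∑ i ∈ s, segment ℝ 0 (t • v i) ⊆ closedBall 0 (t * R) := by
      refine sum_segment_subset_closedBall s _ (by positivity) fun u hu => ?_
      have : ∀ i, max ⟪t • v i, u⟫ 0 = t * max ⟪v i, u⟫ 0 := fun i => by
        rw [real_inner_smul_left, mul_max_of_nonneg _ _ ht.le, mul_zero]
      simp only [this, ← Finset.mul_sum]
      exact mul_le_mul_of_nonneg_left (hR u hu) ht.le
    have h3 : K + ∑ i ∈ s, segment ℝ 0 (t • v i) ⊆ (1 + t * R) • K := by
      rw [hK.add_smul zero_le_one (by positivity), one_smul]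
      refine add_subset_add_left (h2.trans ?_)
      rw [← smul_unitClosedBall_of_nonneg (by positivity)]
      exact smul_set_mono hB
    refine h1.trans ((measureReal_mono h3 (hc.smul _).measure_ne_top).trans_eq ?_)
    rw [measureReal_def, Measure.addHaar_smul_of_nonneg _ (by positivity), ENNReal.toReal_mul,
        ENNReal.toReal_ofReal (by positivity), ← measureReal_def]
  have hf : HasDerivAt (fun t : ℝ => volume.real K + t * ∑ i ∈ s, projNorm K (v i))
      (∑ i ∈ s, projNorm K (v i)) 0 := by
    simpa using ((hasDerivAt_id (0 : ℝ)).mul_const (∑ i ∈ s, projNorm K (v i))).const_add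
      (volume.real K)
  have hg : HasDerivAt (fun t : ℝ => (1 + t * R) ^ d * volume.real K)
      (d * R * volume.real K) 0 := by
    simpa using ((((hasDerivAt_id (0 : ℝ)).mul_const R).const_add 1).fun_pow d).mul_const (volume.real K)
  exact hasDerivAt_le_of_le hf hg (by simp) key

theorem integral_projNorm_le [Nontrivial E] (hK : Convex ℝ K) (hc : IsCompact K)
    (hB : closedBall 0 1 ⊆ K) {β : ℝ}
    (hβ : ∀ u : E, ‖u‖ = 1 → projNorm (closedBall (0 : E) 1) u = β) :
    ∫ θ : sphere (0 : E) 1, projNorm K θ ∂(volume : Measure E).toSphere ≤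
      Module.finrank ℝ E * β * volume.real K := by
  set σ := (volume : Measure E).toSphere
  obtain ⟨y₀, hy₀⟩ : ∃ y₀ : E, y₀ ∈ sphere (0 : E) 1 := by
    obtain ⟨x, hx⟩ := exists_ne (0 : E)
    obtain ⟨u, hu, -⟩ := exists_eq_smul_unit hx
    exact ⟨u, by simpa⟩
  have hβ0 : 0 ≤ β := by
    rw [← hβ y₀ (by simpa using hy₀)]
    exact projNorm_nonneg (convex_closedBall _ _) (isCompact_closedBall _ _) _
  set f : ℕ → SimpleFunc (sphere (0 : E) 1) E := fun k =>
    SimpleFunc.approxOn (fun θ => (θ : E)) measurable_subtype_coe (sphere (0 : E) 1) y₀ hy₀ k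
    with hf
  have hmem : ∀ k θ, ‖f k θ‖ = 1 := fun k θ => by
    simpa using SimpleFunc.approxOn_mem measurable_subtype_coe hy₀ k θ
  have hlim : ∀ θ, Tendsto (fun k => f k θ) atTop (𝓝 (θ : E)) := fun θ =>
    SimpleFunc.tendsto_approxOn measurable_subtype_coe hy₀ (subset_closure θ.2)
  have hsum : ∀ (k : ℕ) (g : E → ℝ), g 0 = 0 →
      ∑ x ∈ (f k).range, σ.real (f k ⁻¹' {x}) * g x = ∫ θ, g (f k θ) ∂σ := by
    intro k g hg
    have := SimpleFunc.map_integral (f k) g (SimpleFunc.integrable_of_isFiniteMeasure (μ := σ) _) hg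
    rw [SimpleFunc.integral_eq_integral _ (SimpleFunc.integrable_of_isFiniteMeasure _)] at this
    simpa using this.symm
  have hint : ∀ (k : ℕ) (g : E → ℝ), Integrable (fun θ => g (f k θ)) σ := fun k g =>
    SimpleFunc.integrable_of_isFiniteMeasure ((f k).map g)
  set δ : ℕ → ℝ := fun k => ∫ θ : sphere (0 : E) 1, ‖f k θ - θ‖ ∂σ with hδ
  have hmeas : ∀ k, AEStronglyMeasurable (fun θ : sphere (0 : E) 1 => ‖f k θ - θ‖) σ := fun k =>
    (((f k).measurable.sub measurable_subtype_coe).norm).aestronglyMeasurable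
  have hbd : ∀ k (θ : sphere (0 : E) 1), ‖‖f k θ - θ‖‖ ≤ 2 := fun k θ => by
    rw [norm_norm]
    refine (norm_sub_le _ _).trans ?_
    rw [hmem, norm_eq_of_mem_sphere]; norm_num
  have hδlim : Tendsto δ atTop (𝓝 0) := by
    have h := tendsto_integral_of_dominated_convergence (μ := σ) (fun _ => (2 : ℝ)) hmeas
      (integrable_const _) (fun k => ae_of_all _ (hbd k))
      (ae_of_all _ fun θ => ((hlim θ).sub_const (θ : E)).norm)
    simpa using h
  have hstep : ∀ k, ∫ θ, projNorm K (f k θ) ∂σ ≤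
      Module.finrank ℝ E * (β + δ k) * volume.real K := by
    intro k
    have hδ0 : 0 ≤ δ k := integral_nonneg fun θ => norm_nonneg _
    have h := sum_projNorm_le hK hc hB (f k).range (fun x => σ.real (f k ⁻¹' {x}) • x)
      (R := β + δ k) (by positivity) ?_
    · simp only [projNorm_smul hK hc measureReal_nonneg] at h
      rwa [hsum k _ (projNorm_zero K)] at h
    · intro u hu
      have : ∀ x : E, max ⟪σ.real (f k ⁻¹' {x}) • x, u⟫ 0 =
          σ.real (f k ⁻¹' {x}) * max ⟪x, u⟫ 0 := fun x => by
        rw [real_inner_smul_left, mul_max_of_nonneg _ _ measureReal_nonneg, mul_zero]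
      simp only [this]
      have hi1 : Integrable (fun θ : sphere (0 : E) 1 => max ⟪(θ : E), u⟫ 0) σ :=
        integrable_sphere_of_continuous (by fun_prop)
      have hi2 : Integrable (fun θ : sphere (0 : E) 1 => ‖f k θ - θ‖) σ :=
        Integrable.of_bound (hmeas k) 2 (ae_of_all _ (hbd k))
      rw [hsum k (fun x => max ⟪x, u⟫ 0) (by simp)]
      calc ∫ θ, max ⟪f k θ, u⟫ 0 ∂σ
          ≤ ∫ θ : sphere (0 : E) 1, (max ⟪(θ : E), u⟫ 0 + ‖f k θ - θ‖) ∂σ := by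
            refine integral_mono (hint k fun x => max ⟪x, u⟫ 0) (hi1.add hi2) fun θ => ?_
            have h1 : ⟪f k θ - θ, u⟫ ≤ ‖f k θ - θ‖ := by
              simpa [hu] using real_inner_le_norm (f k θ - θ) u
            rw [inner_sub_left] at h1
            refine max_le ?_ (add_nonneg (le_max_right _ _) (norm_nonneg _))
            linarith [le_max_left ⟪(θ : E), u⟫ 0]
        _ = (∫ θ : sphere (0 : E) 1, max ⟪(θ : E), u⟫ 0 ∂σ) + δ k := integral_add hi1 hi2
        _ ≤ β + δ k := by
            rw [← hβ u hu]
            exact add_le_add_left (integral_max_inner_le hu) _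
  obtain ⟨C, hC⟩ := (isCompact_sphere (0 : E) 1).exists_bound_of_continuousOn
    (continuous_projNorm hK hc).continuousOn
  have hlim1 : Tendsto (fun k => ∫ θ, projNorm K (f k θ) ∂σ) atTop
      (𝓝 (∫ θ : sphere (0 : E) 1, projNorm K θ ∂σ)) :=
    tendsto_integral_of_dominated_convergence (fun _ => C)
      (fun k => (hint k _).aestronglyMeasurable) (integrable_const _)
      (fun k => ae_of_all _ fun θ => hC _ (by simpa using hmem k θ))
      (ae_of_all _ fun θ => ((continuous_projNorm hK hc).tendsto _).comp (hlim θ))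
  have hlim2 : Tendsto (fun k => Module.finrank ℝ E * (β + δ k) * volume.real K) atTop
      (𝓝 (Module.finrank ℝ E * β * volume.real K)) := by
    simpa using ((hδlim.const_add β).const_mul (Module.finrank ℝ E : ℝ)).mul_const (volume.real K)
  exact le_of_tendsto_of_tendsto' hlim1 hlim2 hstep

end SegmentSums

section VolumeRatio

open scoped Pointwise

variable {E : Type*} [NormedAddCommGroup E] [InnerProductSpace ℝ E] [FiniteDimensional ℝ E]
  [MeasurableSpace E] [BorelSpace E] {K : Set E}

theorem toSphere_real_univ [Nontrivial E] :
    (volume : Measure E).toSphere.real univ =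
      Module.finrank ℝ E * volume.real (closedBall (0 : E) 1) := by
  rw [Measure.toSphere_real_apply_univ, measureReal_def, measureReal_def,
    Measure.addHaar_closedBall_eq_addHaar_ball]

theorem volume_polarProj_eq_integral [Nontrivial E] (hK : Convex ℝ K) (hc : IsCompact K)
    (hi : (interior K).Nonempty) :
    volume.real (polarProj K) = (∫ θ : sphere (0 : E) 1,
      (projNorm K θ)⁻¹ ^ Module.finrank ℝ E ∂(volume : Measure E).toSphere) /
        Module.finrank ℝ E :=
  volumeReal_sublevel_homogeneous (continuous_projNorm hK hc).measurable
    (fun x hx => projNorm_pos hK hc hi (norm_ne_zero_iff.1 (by simp [hx])))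
    (fun _ x hr => projNorm_smul hK hc hr.le x)

omit [InnerProductSpace ℝ E] [FiniteDimensional ℝ E] [MeasurableSpace E] [BorelSpace E] in
theorem interior_unitBall_nonempty : (interior (closedBall (0 : E) 1)).Nonempty :=
  ⟨0, ball_subset_interior_closedBall (mem_ball_self one_pos)⟩

theorem volume_unitBall_pos : 0 < volume.real (closedBall (0 : E) 1) :=
  ENNReal.toReal_pos (measure_closedBall_pos _ _ one_pos).ne' measure_closedBall_lt_top.ne

theorem volume_polarProj_unitBall [Nontrivial E] {β : ℝ}
    (hβ : ∀ u : E, ‖u‖ = 1 → projNorm (closedBall (0 : E) 1) u = β) :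
    volume.real (polarProj (closedBall (0 : E) 1)) =
      volume.real (closedBall (0 : E) 1) * β⁻¹ ^ Module.finrank ℝ E := by
  have hd : (0 : ℝ) < Module.finrank ℝ E := Nat.cast_pos.2 Module.finrank_pos
  rw [volume_polarProj_eq_integral (convex_closedBall _ _) (isCompact_closedBall _ _)
    interior_unitBall_nonempty]
  have : ∀ θ : sphere (0 : E) 1, projNorm (closedBall (0 : E) 1) θ = β := fun θ => hβ _ (by simp)
  simp only [this, integral_const, toSphere_real_univ, smul_eq_mul]
  field_simp

theorem one_sub_mul_le_inv_pow {s : ℝ} (hs : 0 < s) (d : ℕ) : 1 + d * (1 - s) ≤ s⁻¹ ^ d := by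
  have h1 : 1 - s ≤ s⁻¹ - 1 := by
    have h2 : s * s⁻¹ = 1 := mul_inv_cancel₀ hs.ne'
    nlinarith [sq_nonneg (s - 1), inv_pos.2 hs, mul_nonneg (inv_pos.2 hs).le (sq_nonneg (s - 1))]
  have h3 := one_add_mul_le_pow (a := s⁻¹ - 1) (by linarith [inv_pos.2 hs]) d
  rw [add_sub_cancel] at h3
  refine le_trans ?_ h3
  gcongr

theorem volume_polarProj_ge_of_unitBall_subset [Nontrivial E] (hK : Convex ℝ K)
    (hc : IsCompact K) (hB : closedBall 0 1 ⊆ K) {β : ℝ}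
    (hβ : ∀ u : E, ‖u‖ = 1 → projNorm (closedBall (0 : E) 1) u = β) (hβ0 : 0 < β) :
    volume.real (closedBall (0 : E) 1) ^ (Module.finrank ℝ E + 1) ≤
      volume.real (polarProj K) * (β * volume.real K) ^ Module.finrank ℝ E := by
  have hd : (0 : ℝ) < Module.finrank ℝ E := Nat.cast_pos.2 Module.finrank_pos
  have hi : (interior K).Nonempty := interior_unitBall_nonempty.mono (interior_mono hB)
  have hint := integral_projNorm_le hK hc hB hβ
  rw [volume_polarProj_eq_integral hK hc hi]
  set d := Module.finrank ℝ E
  set κ := volume.real (closedBall (0 : E) 1) with hκ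
  set σ := (volume : Measure E).toSphere
  have hκ0 : 0 < κ := volume_unitBall_pos
  have hV : 0 < volume.real K := hκ0.trans_le (measureReal_mono hB hc.measure_ne_top)
  set a := β * volume.real K / κ with ha
  have ha0 : 0 < a := by positivity
  have hpos : ∀ θ : sphere (0 : E) 1, 0 < projNorm K θ := fun θ =>
    projNorm_pos hK hc hi (norm_ne_zero_iff.1 (by simp))
  have hcont : Continuous fun θ : sphere (0 : E) 1 => projNorm K θ :=
    (continuous_projNorm hK hc).comp continuous_subtype_val
  have hI : Integrable (fun θ : sphere (0 : E) 1 => projNorm K θ) σ :=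
    integrable_sphere_of_continuous hcont
  have h1 : ∫ θ : sphere (0 : E) 1, a⁻¹ ^ d * ((1 + d) - d / a * projNorm K θ) ∂σ ≤
      ∫ θ : sphere (0 : E) 1, (projNorm K θ)⁻¹ ^ d ∂σ := by
    refine integral_mono (((integrable_const _).sub (hI.const_mul _)).const_mul _)
      (integrable_sphere_of_continuous ((hcont.inv₀ fun θ => (hpos θ).ne').pow _)) fun θ => ?_
    have h := one_sub_mul_le_inv_pow (div_pos (hpos θ) ha0) d
    calc a⁻¹ ^ d * ((1 + d) - d / a * projNorm K θ)
        = a⁻¹ ^ d * (1 + d * (1 - projNorm K θ / a)) := by ring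
      _ ≤ a⁻¹ ^ d * (projNorm K θ / a)⁻¹ ^ d := by gcongr
      _ = (projNorm K θ)⁻¹ ^ d := by
          rw [← mul_pow, inv_div (projNorm K θ) a, ← mul_div_assoc, inv_mul_cancel₀ ha0.ne', one_div]
  rw [integral_const_mul, integral_sub (integrable_const _) (hI.const_mul _), integral_const,
    integral_const_mul, toSphere_real_univ, smul_eq_mul] at h1
  have h2 : a⁻¹ ^ d * (d * κ) ≤ ∫ θ : sphere (0 : E) 1, (projNorm K θ)⁻¹ ^ d ∂σ := by
    refine le_trans ?_ h1
    refine mul_le_mul_of_nonneg_left ?_ (by positivity)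
    have h3 : d / a * ∫ θ : sphere (0 : E) 1, projNorm K θ ∂σ ≤ d / a * (d * β * volume.real K) :=
      by gcongr
    have h4 : d / a * (d * β * volume.real K) = d * d * κ := by rw [ha]; field_simp
    rw [h4] at h3
    linarith
  rw [show β * volume.real K = a * κ by rw [ha]; field_simp]
  rw [div_mul_eq_mul_div, le_div_iff₀ hd]
  calc κ ^ (d + 1) * d = a⁻¹ ^ d * (d * κ) * (a * κ) ^ d := by
        rw [mul_pow, inv_pow]; field_simp; ring
    _ ≤ _ := by gcongr

theorem volume_polarProj_ge [Nontrivial E] (hK : Convex ℝ K)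
    (hc : IsCompact K) (c : E) (T : E ≃ₗ[ℝ] E) (hB : (fun x => c + T x) '' closedBall 0 1 ⊆ K)
    {β : ℝ} (hβ : ∀ u : E, ‖u‖ = 1 → projNorm (closedBall (0 : E) 1) u = β) (hβ0 : 0 < β) :
    volume.real ((fun x => c + T x) '' closedBall (0 : E) 1) *
      volume.real (closedBall (0 : E) 1) ^ Module.finrank ℝ E ≤
      volume.real (polarProj K) * (β * volume.real K) ^ Module.finrank ℝ E := by
  set D := |LinearMap.det (T : E →ₗ[ℝ] E)| with hD
  have hD0 : 0 < D := abs_pos.2 (LinearEquiv.isUnit_det' T).ne_zero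
  set L : Set E := (fun x => c + T x) ⁻¹' K with hL
  have hLK : K = (c + ·) '' (T '' L) := by
    rw [hL, image_image]
    refine (image_preimage_eq K fun y => ⟨T.symm (y - c), by simp⟩).symm
  have hL1 : Convex ℝ L :=
    (hK.translate_preimage_right c).linear_preimage (T : E →ₗ[ℝ] E)
  have hL2 : IsCompact L := by
    have : L = (fun y => T.symm (y - c)) '' K := by
      rw [hLK, image_image, image_image]
      simp
    rw [this]
    exact hc.image (T.symm.toContinuousLinearEquiv.continuous.comp (continuous_id.sub
      continuous_const))
  have hLB : closedBall 0 1 ⊆ L := image_subset_iff.1 hB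
  have himg : ∀ (b : E) (S : Set E),
      volume.real ((fun x => b + T x) '' S) = D * volume.real S := by
    intro b S
    rw [show (fun x => b + T x) '' S = (b + ·) '' ((T : E →ₗ[ℝ] E) '' S) by
      rw [image_image]; rfl, measureReal_def, image_add_left, measure_preimage_add,
      Measure.addHaar_image_linearMap, ENNReal.toReal_mul, ENNReal.toReal_ofReal hD0.le,
      measureReal_def]
  have hKv : volume.real K = D * volume.real L := by
    rw [← himg c, hLK, image_image]
  have hP : polarProj K = (fun x => 0 + T x) '' (D⁻¹ • polarProj L) := by
    ext y
    obtain ⟨x, rfl⟩ := T.surjective y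
    simp only [zero_add, T.injective.mem_set_image]
    rw [mem_smul_set_iff_inv_smul_mem₀ (inv_ne_zero hD0.ne'), inv_inv]
    change projNorm K (T x) ≤ 1 ↔ projNorm L (D • x) ≤ 1
    rw [hLK, projNorm_add_left, projNorm_image, projNorm_smul hL1 hL2 hD0.le]
  have hPv : volume.real (polarProj K) = D * (D⁻¹ ^ Module.finrank ℝ E *
      volume.real (polarProj L)) := by
    rw [hP, himg, measureReal_def, Measure.addHaar_smul_of_nonneg _ (inv_nonneg.2 hD0.le),
      ENNReal.toReal_mul, ENNReal.toReal_ofReal (by positivity), ← measureReal_def]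
  have h := volume_polarProj_ge_of_unitBall_subset hL1 hL2 hLB hβ hβ0
  rw [himg, hKv, hPv]
  set d := Module.finrank ℝ E
  set κ := volume.real (closedBall (0 : E) 1)
  calc D * κ * κ ^ d = D * κ ^ (d + 1) := by ring
    _ ≤ D * (volume.real (polarProj L) * (β * volume.real L) ^ d) := by gcongr
    _ = _ := by
      rw [show β * (D * volume.real L) = D * (β * volume.real L) by ring, mul_pow D, inv_pow]
      field_simp

/-- A comparison of volumes for convex bodies whose polar projection bodies are comparable. -/
theorem volume_ellipsoid_mul_pow_le [Nontrivial E] {K L : Set E} (hK : Convex ℝ K)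
    (hKc : IsCompact K) (hKi : (interior K).Nonempty) (hKs : ∀ x ∈ K, -x ∈ K) (hL : Convex ℝ L)
    (hLc : IsCompact L) (c : E) (T : E ≃ₗ[ℝ] E)
    (hB : (fun x => c + T x) '' closedBall 0 1 ⊆ L)
    (h : volume.real (polarProj L) ≤ volume.real (polarProj K)) :
    volume.real ((fun x => c + T x) '' closedBall (0 : E) 1) *
      volume.real K ^ (Module.finrank ℝ E - 1) ≤ volume.real L ^ Module.finrank ℝ E := by
  obtain ⟨x, hx⟩ := exists_ne (0 : E)
  obtain ⟨v, hv, -⟩ := exists_eq_smul_unit hx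
  set β := projNorm (closedBall (0 : E) 1) v with hβ
  have hβu : ∀ u : E, ‖u‖ = 1 → projNorm (closedBall (0 : E) 1) u = β := fun u hu =>
    projNorm_closedBall_unit hu hv 1
  have hβ0 : 0 < β := projNorm_unitBall_pos hv
  have h1 := petty_projection_inequality (E := E) Module.finrank_pos hK hKc hKi hKs
  have h2 := volume_polarProj_ge hL hLc c T hB hβu hβ0
  rw [volume_polarProj_unitBall hβu] at h1
  obtain ⟨m, hm⟩ := Nat.exists_eq_add_one.2 (Module.finrank_pos (R := ℝ) (M := E))
  rw [hm] at h1 h2 ⊢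
  rw [Nat.add_sub_cancel] at h1 ⊢
  set κ := volume.real (closedBall (0 : E) 1)
  set V := volume.real ((fun x => c + T x) '' closedBall (0 : E) 1)
  have hκ0 : 0 < κ := volume_unitBall_pos
  refine le_of_mul_le_mul_right ?_ (pow_pos hκ0 (m + 1))
  calc V * volume.real K ^ m * κ ^ (m + 1)
      = volume.real K ^ m * (V * κ ^ (m + 1)) := by ring
    _ ≤ volume.real K ^ m * (volume.real (polarProj K) * (β * volume.real L) ^ (m + 1)) := by
        have := h2.trans (mul_le_mul_of_nonneg_right h (by positivity))
        gcongr
    _ = volume.real K ^ m * volume.real (polarProj K) * (β * volume.real L) ^ (m + 1) := by ring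
    _ ≤ κ ^ m * (κ * β⁻¹ ^ (m + 1)) * (β * volume.real L) ^ (m + 1) := by gcongr
    _ = volume.real L ^ (m + 1) * κ ^ (m + 1) := by
        rw [mul_pow, inv_pow]; field_simp; ring

end VolumeRatio

section SphereMeasure

open Filter Topology
open scoped Pointwise

variable {E : Type*} [NormedAddCommGroup E] [InnerProductSpace ℝ E] [FiniteDimensional ℝ E]
  [MeasurableSpace E] [BorelSpace E]

theorem eq_smul_add_of_measure_closedBall_eq {ρ μ : Measure E} [IsFiniteMeasure ρ]
    [IsFiniteMeasure μ] {S : Set E} (hS : μ Sᶜ = 0) (hac : ρ ≪ μ)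
    (hρ : ∀ x ∈ S, ∀ y ∈ S, ∀ r, ρ (closedBall x r) = ρ (closedBall y r))
    (hμ : ∀ x ∈ S, ∀ y ∈ S, ∀ r, μ (closedBall x r) = μ (closedBall y r)) :
    ∃ c : ℝ≥0∞, ρ = c • μ := by
  rcases eq_zero_or_neZero μ with rfl | hne
  · exact ⟨0, by simpa using Measure.absolutelyContinuous_zero_iff.1 hac⟩
  have hae : ∀ᵐ x ∂μ, x ∈ S ∧ Tendsto (fun r => ρ (closedBall x r) / μ (closedBall x r)) (𝓝[>] 0)
      (𝓝 (ρ.rnDeriv μ x)) := by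
    filter_upwards [Besicovitch.ae_tendsto_rnDeriv ρ μ, mem_ae_iff.2 hS] with x h1 h2
    exact ⟨h2, h1⟩
  obtain ⟨x₀, h0, hx₀⟩ := hae.exists
  refine ⟨ρ.rnDeriv μ x₀, ?_⟩
  rw [← Measure.withDensity_rnDeriv_eq ρ μ hac, ← withDensity_const]
  conv_rhs => rw [Measure.withDensity_rnDeriv_eq ρ μ hac]
  refine withDensity_congr_ae ?_
  filter_upwards [hae] with x ⟨h1, hx⟩
  refine tendsto_nhds_unique hx ?_
  simpa only [hρ x h1 x₀ h0, hμ x h1 x₀ h0] using hx₀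

theorem measure_mul_univ_eq_of_measure_closedBall_eq {μ ν : Measure E} [IsFiniteMeasure μ]
    [IsFiniteMeasure ν] {S : Set E} (hSμ : μ Sᶜ = 0) (hSν : ν Sᶜ = 0)
    (hμ : ∀ x ∈ S, ∀ y ∈ S, ∀ r, μ (closedBall x r) = μ (closedBall y r))
    (hν : ∀ x ∈ S, ∀ y ∈ S, ∀ r, ν (closedBall x r) = ν (closedBall y r)) (A : Set E) :
    μ A * ν univ = ν A * μ univ := by
  have hS : (μ + ν) Sᶜ = 0 := by simp [hSμ, hSν]
  have hadd : ∀ x ∈ S, ∀ y ∈ S, ∀ r, (μ + ν) (closedBall x r) = (μ + ν) (closedBall y r) := by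
    intro x hx y hy r
    simp only [Measure.add_apply, hμ x hx y hy, hν x hx y hy]
  obtain ⟨c, hc⟩ := eq_smul_add_of_measure_closedBall_eq hS
    (Measure.absolutelyContinuous_of_le (Measure.le_add_right le_rfl)) hμ hadd
  obtain ⟨c', hc'⟩ := eq_smul_add_of_measure_closedBall_eq hS
    (Measure.absolutelyContinuous_of_le (Measure.le_add_left le_rfl)) hν hadd
  have h1 : ∀ B, μ B = c * (μ + ν) B := fun B => by
    conv_lhs => rw [hc]
    rfl
  have h2 : ∀ B, ν B = c' * (μ + ν) B := fun B => by
    conv_lhs => rw [hc']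
    rfl
  rw [h1 A, h1 univ, h2 A, h2 univ]
  ring

omit [FiniteDimensional ℝ E] [MeasurableSpace E] [BorelSpace E] in
theorem exists_isometry_apply_eq {x y : E} (h : ‖x‖ = ‖y‖) : ∃ T : E ≃ₗᵢ[ℝ] E, T x = y :=
  ⟨_, Submodule.reflection_sub h⟩

omit [FiniteDimensional ℝ E] [MeasurableSpace E] [BorelSpace E] in
theorem isometry_image_sphere (T : E ≃ₗᵢ[ℝ] E) (r : ℝ) : T '' sphere 0 r = sphere 0 r := by
  simp [T.image_sphere]

omit [FiniteDimensional ℝ E] in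
theorem hausdorffMeasure_restrict_sphere_closedBall_eq (s : ℝ) :
    ∀ x ∈ sphere (0 : E) 1, ∀ y ∈ sphere (0 : E) 1, ∀ r,
      (μH[s].restrict (sphere (0 : E) 1)) (closedBall x r) =
        (μH[s].restrict (sphere (0 : E) 1)) (closedBall y r) := by
  intro x hx y hy r
  rw [mem_sphere_zero_iff_norm] at hx hy
  obtain ⟨T, rfl⟩ := exists_isometry_apply_eq (hx.trans hy.symm)
  rw [Measure.restrict_apply measurableSet_closedBall, Measure.restrict_apply
    measurableSet_closedBall, ← T.image_closedBall, ← isometry_image_sphere T,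
    ← image_inter T.injective]
  conv_lhs => rw [isometry_image_sphere T]
  exact (T.toIsometryEquiv.hausdorffMeasure_image s _).symm

theorem map_toSphere_apply {S : Set E} (hS : MeasurableSet S) :
    ((volume : Measure E).toSphere.map Subtype.val) S =
      Module.finrank ℝ E * volume (Ioo (0 : ℝ) 1 • (sphere 0 1 ∩ S)) := by
  rw [Measure.map_apply measurable_subtype_coe hS, Measure.toSphere_apply' _
    (measurable_subtype_coe hS), Subtype.image_preimage_coe]

theorem map_toSphere_closedBall_eq :
    ∀ x ∈ sphere (0 : E) 1, ∀ y ∈ sphere (0 : E) 1, ∀ r,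
      ((volume : Measure E).toSphere.map Subtype.val) (closedBall x r) =
        ((volume : Measure E).toSphere.map Subtype.val) (closedBall y r) := by
  intro x hx y hy r
  rw [mem_sphere_zero_iff_norm] at hx hy
  obtain ⟨T, rfl⟩ := exists_isometry_apply_eq (hx.trans hy.symm)
  rw [map_toSphere_apply measurableSet_closedBall, map_toSphere_apply measurableSet_closedBall,
    ← T.image_closedBall, ← isometry_image_sphere T, ← image_inter T.injective]
  conv_lhs => rw [isometry_image_sphere T]
  rw [← volume_image_isometry T]
  congr 2
  ext z
  simp only [Set.mem_smul, mem_image]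
  constructor
  · rintro ⟨_, ⟨a, ha, b, hb, rfl⟩, rfl⟩
    exact ⟨a, ha, T b, ⟨b, hb, rfl⟩, by simp⟩
  · rintro ⟨a, ha, _, ⟨b, hb, rfl⟩, rfl⟩
    exact ⟨a • b, ⟨a, ha, b, hb, rfl⟩, by simp⟩

omit [MeasurableSpace E] [BorelSpace E] in
theorem exists_lipschitzOnWith_halfSphere {v : E} (hv : ‖v‖ = 1) :
    ∃ C, ∃ f : (ℝ ∙ v)ᗮ → E, LipschitzOnWith C f (closedBall 0 2) ∧
      {x ∈ sphere (0 : E) 1 | ⟪v, x⟫ ≤ 0} ⊆ f '' closedBall 0 2 := by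
  have hcd : ContDiff ℝ 1 (fun w : (ℝ ∙ v)ᗮ => stereoInvFunAux v (w : E)) :=
    contDiff_stereoInvFunAux.comp (ℝ ∙ v)ᗮ.subtypeL.contDiff
  obtain ⟨C, hC⟩ := hcd.contDiffOn.exists_lipschitzOnWith one_ne_zero
    (convex_closedBall (0 : (ℝ ∙ v)ᗮ) 2) (isCompact_closedBall _ _)
  refine ⟨C, _, hC, ?_⟩
  rintro x ⟨hx, hxv⟩
  have hxv' : x ≠ v := by
    rintro rfl
    rw [real_inner_self_eq_norm_sq, hv] at hxv
    norm_num at hxv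
  refine ⟨stereoToFun v x, ?_, congrArg Subtype.val (stereo_left_inv hv (x := ⟨x, hx⟩) hxv')⟩
  have h1 : ‖(ℝ ∙ v)ᗮ.orthogonalProjectionOnto x‖ ≤ 1 := by
    rw [← mem_sphere_zero_iff_norm.1 hx]
    exact Submodule.norm_orthogonalProjectionOnto_apply_le _ _
  rw [mem_closedBall_zero_iff, stereoToFun_apply, norm_smul, innerSL_apply_apply, Real.norm_eq_abs,
    abs_of_pos (div_pos two_pos (by linarith))]
  have h2 : 2 / (1 - ⟪v, x⟫) ≤ 2 := div_le_self two_pos.le (by linarith)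
  nlinarith [norm_nonneg ((ℝ ∙ v)ᗮ.orthogonalProjectionOnto x)]

omit [MeasurableSpace E] [BorelSpace E] in
theorem finrank_orthogonal_span {v : E} (hv : ‖v‖ = 1) :
    (Module.finrank ℝ (ℝ ∙ v)ᗮ : ℝ) = Module.finrank ℝ E - 1 := by
  have h1 := Submodule.finrank_add_finrank_orthogonal (ℝ ∙ v)
  rw [finrank_span_singleton (norm_ne_zero_iff.1 (by simp [hv]))] at h1
  rw [← h1]
  push_cast
  ring

theorem hausdorffMeasure_halfSphere_lt_top {v : E} (hv : ‖v‖ = 1) :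
    μH[(Module.finrank ℝ E : ℝ) - 1] {x ∈ sphere (0 : E) 1 | ⟪v, x⟫ ≤ 0} < ⊤ := by
  obtain ⟨C, f, hf, hsub⟩ := exists_lipschitzOnWith_halfSphere hv
  rw [← finrank_orthogonal_span hv]
  refine (measure_mono hsub).trans_lt ((hf.hausdorffMeasure_image_le (Nat.cast_nonneg _)).trans_lt ?_)
  refine ENNReal.mul_lt_top (by finiteness) (isCompact_closedBall _ _).measure_lt_top

theorem hausdorffMeasure_sphere_lt_top [Nontrivial E] :
    μH[(Module.finrank ℝ E : ℝ) - 1] (sphere (0 : E) 1) < ⊤ := by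
  obtain ⟨v, hv⟩ := exists_norm_eq E zero_le_one
  have hsub : sphere (0 : E) 1 ⊆ {x ∈ sphere (0 : E) 1 | ⟪v, x⟫ ≤ 0} ∪
      {x ∈ sphere (0 : E) 1 | ⟪-v, x⟫ ≤ 0} := by
    intro x hx
    rcases le_total ⟪v, x⟫ 0 with h | h
    · exact Or.inl ⟨hx, h⟩
    · exact Or.inr ⟨hx, by simpa [inner_neg_left] using h⟩
  exact (measure_mono hsub).trans_lt ((measure_union_le _ _).trans_lt (ENNReal.add_lt_top.2
    ⟨hausdorffMeasure_halfSphere_lt_top hv,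
      hausdorffMeasure_halfSphere_lt_top (by rwa [norm_neg])⟩))

theorem hausdorffMeasure_sphere_pos [Nontrivial E] :
    0 < μH[(Module.finrank ℝ E : ℝ) - 1] (sphere (0 : E) 1) := by
  obtain ⟨v, hv⟩ := exists_norm_eq E zero_le_one
  have hfr := finrank_orthogonal_span hv
  rw [← hfr]
  refine lt_of_lt_of_le ?_ (hausdorffMeasure_orthogonalProjectionOnto_le (ℝ ∙ v)ᗮ _ _
    (Nat.cast_nonneg _))
  refine lt_of_lt_of_le (measure_closedBall_pos (μ := μH[Module.finrank ℝ (ℝ ∙ v)ᗮ]) 0 one_pos)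
    (measure_mono ?_)
  intro w hw
  have hw1 : ‖(w : E)‖ ≤ 1 := by simpa using hw
  have hwv : ⟪(w : E), v⟫ = 0 := Submodule.mem_orthogonal_singleton_iff_inner_left.1 w.2
  have hs : 0 ≤ 1 - ‖(w : E)‖ ^ 2 := by nlinarith [norm_nonneg (w : E)]
  refine ⟨w + √(1 - ‖(w : E)‖ ^ 2) • v, ?_, ?_⟩
  · rw [mem_sphere_zero_iff_norm, ← sq_eq_sq₀ (norm_nonneg _) zero_le_one, norm_add_sq_real,
      norm_smul, inner_smul_right, hwv, hv, mul_one, Real.norm_eq_abs, sq_abs, Real.sq_sqrt hs]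
    ring
  · rw [map_add, map_smul, Submodule.orthogonalProjectionOnto_mem_subspace_eq_self,
      Submodule.orthogonalProjectionOnto_orthogonal_apply_eq_zero
        (Submodule.mem_span_singleton_self v)]
    simp

/-- Up to a positive finite factor, surface measure on the sphere is the cone measure. -/
theorem hausdorffMeasure_inter_sphere_div [Nontrivial E] {A : Set E} (hA : MeasurableSet A) :
    μH[(Module.finrank ℝ E : ℝ) - 1] (A ∩ sphere (0 : E) 1) /
        μH[(Module.finrank ℝ E : ℝ) - 1] (sphere (0 : E) 1) =
      (volume : Measure E).toSphere (Subtype.val ⁻¹' A) / (volume : Measure E).toSphere univ := by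
  set μ : Measure E := μH[(Module.finrank ℝ E : ℝ) - 1].restrict (sphere (0 : E) 1) with hμ
  set ν : Measure E := (volume : Measure E).toSphere.map Subtype.val with hν
  have hμu : μ univ = μH[(Module.finrank ℝ E : ℝ) - 1] (sphere (0 : E) 1) := by simp [hμ]
  have hνu : ν univ = (volume : Measure E).toSphere univ := by
    rw [hν, Measure.map_apply measurable_subtype_coe MeasurableSet.univ, preimage_univ]
  have : IsFiniteMeasure μ := ⟨hμu ▸ hausdorffMeasure_sphere_lt_top⟩
  have : IsFiniteMeasure ν := ⟨by rw [hνu]; exact measure_lt_top _ _⟩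
  have hms : MeasurableSet (sphere (0 : E) 1)ᶜ := isClosed_sphere.measurableSet.compl
  have h := measure_mul_univ_eq_of_measure_closedBall_eq (μ := μ) (ν := ν)
    (S := sphere (0 : E) 1) (by simp [hμ, Measure.restrict_apply hms])
    (by
      rw [hν, Measure.map_apply measurable_subtype_coe hms]
      exact (congrArg _ (eq_empty_of_forall_notMem (s := Subtype.val ⁻¹' (sphere (0 : E) 1)ᶜ)
        fun x hx => hx x.2)).trans measure_empty)
    (hausdorffMeasure_restrict_sphere_closedBall_eq _) map_toSphere_closedBall_eq A
  rw [hμu, hνu, Measure.restrict_apply hA, hν, Measure.map_apply measurable_subtype_coe hA] at h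
  have hne : (volume : Measure E).toSphere univ ≠ 0 := by
    have : Nonempty (sphere (0 : E) 1) := (NormedSpace.sphere_nonempty.2 zero_le_one).to_subtype
    exact (Measure.measure_univ_pos.2 (NeZero.ne _)).ne'
  rw [ENNReal.div_eq_div_iff hne (measure_ne_top _ _) hausdorffMeasure_sphere_pos.ne'
    hausdorffMeasure_sphere_lt_top.ne, mul_comm, h, mul_comm]

end SphereMeasure

section ProjectionDistribution

variable {E : Type*} [NormedAddCommGroup E] [InnerProductSpace ℝ E] [FiniteDimensional ℝ E]
  [MeasurableSpace E] [BorelSpace E]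

open Measure in
theorem exists_volume_eq_smul_hausdorffMeasure (d : ℕ) : ∃ c : ℝ≥0, c ≠ 0 ∧
    ∀ (V : Submodule ℝ E), Module.finrank ℝ V = d →
      (volume : Measure V) = c • μH[d] := by
  refine ⟨_, addHaarScalarFactor_volume_hausdorffMeasure_ne_zero d, ?_⟩
  rintro V rfl
  rw [← euclideanHausdorffMeasure_def, InnerProductSpace.euclideanHausdorffMeasure_eq_volume]

theorem exists_hausdorffMeasure_projection_eq [Nontrivial E] : ∃ c : ℝ, 0 < c ∧
    ∀ (K : Set E), Convex ℝ K → IsCompact K → ∀ θ : E, ‖θ‖ = 1 →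
      μH[(Module.finrank ℝ E : ℝ) - 1] ((fun x => x - ⟪x, θ⟫ • θ) '' K) =
        ENNReal.ofReal (c * projNorm K θ) := by
  obtain ⟨c, hc0, hc⟩ := exists_volume_eq_smul_hausdorffMeasure (E := E) (Module.finrank ℝ E - 1)
  have hd : ((Module.finrank ℝ E - 1 : ℕ) : ℝ) = (Module.finrank ℝ E : ℝ) - 1 :=
    Nat.cast_pred Module.finrank_pos
  refine ⟨c⁻¹, by positivity, fun K hK hKc θ hθ => ?_⟩
  have hfr : Module.finrank ℝ (ℝ ∙ θ)ᗮ = Module.finrank ℝ E - 1 := by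
    have := finrank_orthogonal_span hθ
    rw [← hd] at this
    exact_mod_cast this
  have hv : (c : ℝ≥0∞) * μH[((Module.finrank ℝ E - 1 : ℕ) : ℝ)] (lineShadow θ K) =
      volume (lineShadow θ K) := by
    rw [hc _ hfr]
    rfl
  rw [← coe_image_lineShadow hθ, ← hd,
    isometry_subtype_coe.hausdorffMeasure_image (Or.inl (Nat.cast_nonneg _)),
    projNorm_unit hK hKc hθ, ENNReal.ofReal_mul (by positivity), measureReal_def,
    ENNReal.ofReal_toReal (isCompact_lineShadow hθ hKc).measure_lt_top.ne, ← hv, ← NNReal.coe_inv,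
    ENNReal.ofReal_coe_nnreal, ← mul_assoc, ← ENNReal.coe_mul, inv_mul_cancel₀ hc0,
    ENNReal.coe_one, one_mul]

theorem integral_inv_pow_le_of_measure_le {α : Type*} [MeasurableSpace α] {μ : Measure α}
    [IsFiniteMeasure μ] {f g : α → ℝ} (hf : Measurable f) (hg : Measurable g) (hf0 : ∀ x, 0 < f x)
    (hg0 : ∀ x, 0 < g x) {d : ℕ} (hd : d ≠ 0) (hint : Integrable (fun x => (f x)⁻¹ ^ d) μ)
    (h : ∀ t, 0 < t → μ {x | t ≤ f x} ≤ μ {x | t ≤ g x}) :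
    ∫ x, (g x)⁻¹ ^ d ∂μ ≤ ∫ x, (f x)⁻¹ ^ d ∂μ := by
  have hnn : ∀ {k : α → ℝ}, (∀ x, 0 < k x) → 0 ≤ᵐ[μ] fun x => (k x)⁻¹ ^ d := fun hk =>
    Filter.Eventually.of_forall fun x => pow_nonneg (inv_nonneg.2 (hk x).le) d
  have hfm : Measurable fun x => (f x)⁻¹ ^ d := hf.inv.pow_const d
  have hgm : Measurable fun x => (g x)⁻¹ ^ d := hg.inv.pow_const d
  rw [integral_eq_lintegral_of_nonneg_ae (hnn hg0) hgm.aestronglyMeasurable,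
    integral_eq_lintegral_of_nonneg_ae (hnn hf0) hfm.aestronglyMeasurable]
  refine ENNReal.toReal_mono ?_ ?_
  · exact ((lintegral_mono fun x => Real.ofReal_le_enorm _).trans_lt hint.2).ne
  rw [lintegral_eq_lintegral_meas_lt μ (hnn hg0) hgm.aemeasurable,
    lintegral_eq_lintegral_meas_lt μ (hnn hf0) hfm.aemeasurable]
  refine setLIntegral_mono' measurableSet_Ioi fun s hs => ?_
  obtain ⟨t, ht, rfl⟩ : ∃ t : ℝ, 0 < t ∧ t⁻¹ ^ d = s :=
    ⟨(s ^ ((d : ℝ)⁻¹))⁻¹, inv_pos.2 (Real.rpow_pos_of_pos hs _), by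
      rw [inv_inv, Real.rpow_inv_natCast_pow (le_of_lt hs) hd]⟩
  have key : ∀ k : α → ℝ, (∀ x, 0 < k x) → {x | t⁻¹ ^ d < (k x)⁻¹ ^ d} = {x | t ≤ k x}ᶜ := by
    intro k hk
    ext x
    simp only [mem_compl_iff, Set.mem_ofPred_eq, not_le]
    rw [pow_lt_pow_iff_left₀ (inv_pos.2 ht).le (inv_pos.2 (hk x)).le hd, inv_lt_inv₀ ht (hk x)]
  rw [key g hg0, key f hf0, measure_compl (measurableSet_le measurable_const hg) (by finiteness),
    measure_compl (measurableSet_le measurable_const hf) (by finiteness)]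
  exact tsub_le_tsub_left (h t ht) _

theorem volume_polarProj_le_of_toSphere_le [Nontrivial E] {K L : Set E} (hK : Convex ℝ K)
    (hKc : IsCompact K) (hKi : (interior K).Nonempty) (hL : Convex ℝ L) (hLc : IsCompact L)
    (hLi : (interior L).Nonempty)
    (h : ∀ t, 0 < t → (volume : Measure E).toSphere {θ | t ≤ projNorm K θ} ≤
      (volume : Measure E).toSphere {θ | t ≤ projNorm L θ}) :
    volume.real (polarProj L) ≤ volume.real (polarProj K) := by
  rw [volume_polarProj_eq_integral hK hKc hKi, volume_polarProj_eq_integral hL hLc hLi]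
  have hcK := (continuous_projNorm hK hKc).comp (continuous_subtype_val (p := (· ∈ sphere (0 : E) 1)))
  have hcL := (continuous_projNorm hL hLc).comp (continuous_subtype_val (p := (· ∈ sphere (0 : E) 1)))
  have hK0 : ∀ θ : sphere (0 : E) 1, 0 < projNorm K θ := fun θ =>
    projNorm_pos hK hKc hKi (norm_ne_zero_iff.1 (by simp))
  have hL0 : ∀ θ : sphere (0 : E) 1, 0 < projNorm L θ := fun θ =>
    projNorm_pos hL hLc hLi (norm_ne_zero_iff.1 (by simp))
  refine div_le_div_of_nonneg_right ?_ (Nat.cast_nonneg _)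
  refine integral_inv_pow_le_of_measure_le hcK.measurable hcL.measurable hK0 hL0
    Module.finrank_pos.ne' (integrable_sphere_of_continuous ?_) h
  exact (hcK.inv₀ fun θ => (hK0 θ).ne').pow _

end ProjectionDistribution

theorem toSphere_le_of_PiDist_le {n : ℕ} (hn : 2 ≤ n) {K L : Set (Euc n)}
    (hK : IsConvexBody K) (hL : IsConvexBody L)
    (h : ∀ t : ℝ, 0 ≤ t → PiDist n K t ≤ PiDist n L t) {t : ℝ} (ht : 0 < t) :
    (volume : Measure (Euc n)).toSphere {θ | t ≤ projNorm K θ} ≤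
      (volume : Measure (Euc n)).toSphere {θ | t ≤ projNorm L θ} := by
  have : Nonempty (Fin n) := ⟨⟨0, by omega⟩⟩
  obtain ⟨c, hc0, hc⟩ := exists_hausdorffMeasure_projection_eq (E := Euc n)
  have hPi : ∀ M : Set (Euc n), IsConvexBody M → PiDist n M (c * t) =
      (volume : Measure (Euc n)).toSphere {θ | t ≤ projNorm M θ} /
        (volume : Measure (Euc n)).toSphere univ := by
    intro M hM
    have hm : MeasurableSet {θ : Euc n | t ≤ projNorm M θ} :=
      measurableSet_le measurable_const (continuous_projNorm hM.1 hM.2.1).measurable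
    have hd := hausdorffMeasure_inter_sphere_div hm
    rw [finrank_euclideanSpace_fin] at hd
    refine Eq.trans ?_ hd
    unfold PiDist sphHaar
    congr 2
    ext θ
    simp only [mem_inter_iff, Set.mem_ofPred_eq]
    refine and_congr_left fun hθ => ?_
    have hp := hc M hM.1 hM.2.1 θ (mem_sphere_zero_iff_norm.1 hθ)
    rw [finrank_euclideanSpace_fin] at hp
    rw [projVol, hp, ENNReal.ofReal_le_ofReal_iff
      (mul_nonneg hc0.le (projNorm_nonneg hM.1 hM.2.1 θ)), mul_le_mul_iff_right₀ hc0]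
  have h1 := h (c * t) (by positivity)
  have hne : (volume : Measure (Euc n)).toSphere univ ≠ 0 := by
    have : Nonempty (sphere (0 : Euc n) 1) :=
      (NormedSpace.sphere_nonempty.2 zero_le_one).to_subtype
    exact (Measure.measure_univ_pos.2 (NeZero.ne _)).ne'
  rw [hPi K hK, hPi L hL] at h1
  have h2 := mul_le_mul' h1 (le_refl ((volume : Measure (Euc n)).toSphere univ))
  rwa [ENNReal.div_mul_cancel hne (measure_ne_top _ _),
    ENNReal.div_mul_cancel hne (measure_ne_top _ _)] at h2

theorem IsConvexBody.volume_toReal_pos {n : ℕ} {K : Set (Euc n)} (hK : IsConvexBody K) :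
    0 < (volume K).toReal :=
  ENNReal.toReal_pos ((Measure.measure_pos_of_nonempty_interior _ hK.2.2).ne') hK.2.1.measure_lt_top.ne

theorem IsEllipsoid.isConvexBody {n : ℕ} {E : Set (Euc n)} (hE : IsEllipsoid E) :
    IsConvexBody E := by
  obtain ⟨c, T, rfl⟩ := hE
  have hT : Continuous T := T.toLinearMap.continuous_of_finiteDimensional
  have hcomp : (fun x => c + T x) '' closedBall (0 : Euc n) 1 =
      (fun y => c + y) '' (T '' closedBall (0 : Euc n) 1) := by rw [image_image]
  refine ⟨?_, (isCompact_closedBall _ _).image (by fun_prop), ?_⟩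
  · rw [hcomp]
    exact ((convex_closedBall (0 : Euc n) 1).linear_image T.toLinearMap).translate c
  · let e := T.toContinuousLinearEquiv.toHomeomorph.trans (Homeomorph.addLeft c)
    have he : (fun x => c + T x) '' closedBall (0 : Euc n) 1 = e '' closedBall (0 : Euc n) 1 := rfl
    rw [he, ← e.image_interior]
    exact interior_unitBall_nonempty.image _

theorem IsConvexBody.exists_isEllipsoid_subset {n : ℕ} {L : Set (Euc n)} (hL : IsConvexBody L) :
    ∃ E, IsEllipsoid E ∧ E ⊆ L := by
  obtain ⟨c, hc⟩ := hL.2.2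
  obtain ⟨r, hr, hball⟩ := nhds_basis_closedBall.mem_iff.1 (mem_interior_iff_mem_nhds.1 hc)
  refine ⟨_, ⟨c, LinearEquiv.smulOfNeZero ℝ (Euc n) r hr.ne', rfl⟩, ?_⟩
  rintro _ ⟨x, hx, rfl⟩
  refine hball ?_
  rw [mem_closedBall_zero_iff] at hx
  simp only [LinearEquiv.smulOfNeZero_apply, mem_closedBall, dist_self_add_left, norm_smul,
    Real.norm_eq_abs, abs_of_pos hr]
  nlinarith

theorem rpow_le_of_mul_pow_le {n : ℕ} (hn : n ≠ 0) {e k l : ℝ} (he : 0 < e) (hk : 0 < k)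
    (hl : 0 < l) (h : e * k ^ (n - 1) ≤ l ^ n) :
    k ^ (((n : ℝ) - 1) / n) ≤ (l / e) ^ ((1 : ℝ) / n) * l ^ (((n : ℝ) - 1) / n) := by
  have hd : ((n - 1 : ℕ) : ℝ) = (n : ℝ) - 1 := Nat.cast_pred (Nat.pos_of_ne_zero hn)
  have hpow : ∀ x : ℝ, 0 < x → x ^ (((n : ℝ) - 1) / n) = (x ^ (n - 1)) ^ ((1 : ℝ) / n) := by
    intro x hx
    rw [← Real.rpow_natCast, ← Real.rpow_mul hx.le, hd, mul_one_div]
  rw [hpow k hk, hpow l hl, ← Real.mul_rpow (by positivity) (by positivity)]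
  refine Real.rpow_le_rpow (by positivity) ?_ (by positivity)
  rw [div_mul_eq_mul_div, le_div_iff₀ he, mul_comm, ← pow_succ', Nat.sub_add_cancel
    (Nat.pos_of_ne_zero hn)]
  exact h

/-- If `Π_K(t) ≤ Π_L(t)` for all `t ≥ 0`, then
`|K|^{(n-1)/n} ≤ vr(L)·|L|^{(n-1)/n}`. -/
theorem stmt_16 (n : ℕ) (hn : 2 ≤ n) (K L : Set (Euc n))
    (hK : IsConvexBody K) (hL : IsConvexBody L)
    (hKsym : K = -K) (hLsym : L = -L)
    (h : ∀ t : ℝ, 0 ≤ t → PiDist n K t ≤ PiDist n L t) :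
    (volume K).toReal ^ (((n : ℝ) - 1) / n) ≤
      vr n L * (volume L).toReal ^ (((n : ℝ) - 1) / n) := by
  have hn0 : n ≠ 0 := by omega
  have : Nonempty (Fin n) := ⟨⟨0, by omega⟩⟩
  have hpolar := volume_polarProj_le_of_toSphere_le hK.1 hK.2.1 hK.2.2 hL.1 hL.2.1 hL.2.2
    fun t ht => toSphere_le_of_PiDist_le hn hK hL h ht
  have hpos : 0 < (volume L).toReal ^ (((n : ℝ) - 1) / n) :=
    Real.rpow_pos_of_pos hL.volume_toReal_pos _
  rw [← div_le_iff₀ hpos]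
  obtain ⟨E₀, hE₀, hE₀L⟩ := hL.exists_isEllipsoid_subset
  refine le_csInf ⟨_, E₀, hE₀, hE₀L, rfl⟩ ?_
  rintro _ ⟨E, hE, hEL, rfl⟩
  rw [div_le_iff₀ hpos]
  refine rpow_le_of_mul_pow_le hn0 hE.isConvexBody.volume_toReal_pos hK.volume_toReal_pos
    hL.volume_toReal_pos ?_
  obtain ⟨c, T, rfl⟩ := hE
  have hsymm : ∀ x ∈ K, -x ∈ K := fun x hx => by
    rw [hKsym] at hx
    exact hx
  simpa only [finrank_euclideanSpace_fin, measureReal_def] using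
    volume_ellipsoid_mul_pow_le hK.1 hK.2.1 hK.2.2 hsymm hL.1 hL.2.1 c T hEL hpolar
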